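/- Let (c_g)_{g≥0} be the sequence of rational numbers defined by c_0 = −1, c_1 = 2, c_2 = 98, and c_g = 50(g−1)²·c_{g−1} + (1/2)·Σ_{h=2}^{g−2} c_h·c_{g−h} for g ≥ 3 (the coefficients of the unique formal solution U(X)=Σ_{g≥0} c_g X^{(1−5g)/2} of the Painlevé I equation U'' + U²/16 − X/16 = 0). Then lim_{g→∞} c_g / (50^g·((g−1)!)²) = (1/(2π²))·√(3/5). -/

import Mathlib

open scoped BigOperators

set_option linter.unusedSimpArgs false

noncomputable section

namespace WittenAsym

section


/-- formal power series in `η` with coefficients formal power series in `y` -/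
abbrev B := PowerSeries (PowerSeries ℚ)

/-- double coefficient -/
def cf (g d : ℕ) (f : B) : ℚ := PowerSeries.coeff d (PowerSeries.coeff g f)

lemma cf_ext {f f' : B} (h : ∀ g d, cf g d f = cf g d f') : f = f' := by
  ext g d; exact h g d

@[simp] lemma cf_add (g d) (f f' : B) : cf g d (f + f') = cf g d f + cf g d f' := by simp [cf]
@[simp] lemma cf_sub (g d) (f f' : B) : cf g d (f - f') = cf g d f - cf g d f' := by simp [cf]
@[simp] lemma cf_neg (g d) (f : B) : cf g d (-f) = - cf g d f := by simp [cf]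
@[simp] lemma cf_zero (g d) : cf g d (0 : B) = 0 := by simp [cf]
@[simp] lemma cf_smul (g d) (q : ℚ) (f : B) : cf g d (q • f) = q * cf g d f := by
  simp [cf]

lemma cf_mul (g d) (f f' : B) : cf g d (f * f') =
    ∑ p ∈ Finset.HasAntidiagonal.antidiagonal g, ∑ q ∈ Finset.HasAntidiagonal.antidiagonal d, cf p.1 q.1 f * cf p.2 q.2 f' := by
  simp only [cf, PowerSeries.coeff_mul, map_sum]

/-- build from an array -/
def arr (a : ℕ → ℕ → ℚ) : B := PowerSeries.mk fun g => PowerSeries.mk fun d => a g d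

@[simp] lemma cf_arr (g d a) : cf g d (arr a) = a g d := by simp [cf, arr]

/-- diagonal derivation with weight `α g + β d` -/
def wt (α β : ℚ) : Derivation ℚ B B :=
  Derivation.mk'
    { toFun := fun f => arr fun g d => (α * g + β * d) * cf g d f
      map_add' := by intro f f'; apply cf_ext; intro g d; simp; ring
      map_smul' := by intro f f'; apply cf_ext; intro g d; simp; ring }
    (by
      intro f f'; apply cf_ext; intro g d
      simp only [smul_eq_mul]
      rw [mul_comm f' _]
      simp only [LinearMap.coe_mk, AddHom.coe_mk, cf_arr, smul_eq_mul, cf_add, cf_mul,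
        Finset.mul_sum, ← Finset.sum_add_distrib]
      refine Finset.sum_congr rfl fun p hp => Finset.sum_congr rfl fun q hq => ?_
      rw [Finset.HasAntidiagonal.mem_antidiagonal] at hp hq
      rw [← hp, ← hq]; push_cast; ring)

@[simp] lemma cf_wt (g d : ℕ) (α β : ℚ) (f : B) : cf g d (wt α β f) = (α * g + β * d) * cf g d f := by
  simp [wt]

/-- the variable `y` -/
def yy : B := PowerSeries.C PowerSeries.X
/-- the variable `η` -/
def ee : B := PowerSeries.X

@[simp] lemma cf_yy_zero (g) (f : B) : cf g 0 (yy * f) = 0 := by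
  simp [cf, yy, PowerSeries.coeff_C_mul]
@[simp] lemma cf_yy_succ (g d) (f : B) : cf g (d+1) (yy * f) = cf g d f := by
  simp [cf, yy, PowerSeries.coeff_C_mul]
@[simp] lemma cf_ee_zero (d) (f : B) : cf 0 d (ee * f) = 0 := by
  simp [cf, ee]
@[simp] lemma cf_ee_succ (g d) (f : B) : cf (g+1) d (ee * f) = cf g d f := by
  simp [cf, ee]

lemma alg_identity {R : Type*} [CommRing R] [Algebra ℚ R] (D φ : Derivation ℚ R R)
    (y n γ ρ : R) (Dy : D y = y - y * y) (φy : φ y = - y) (Dn : D n = -5 * n) (φn : φ n = 0)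
    (φγ : φ γ = 0) (com : ∀ f, φ (D f) = D (φ f) - y * φ f)
    (hPI : 4 * n * (D (D γ) - (γ - 1)) + (γ - 1) * (γ - 1) - 1 = 0)
    (hE : 6 * (y * y) * φ ρ + 2 * (2 - 3 * y + y * γ) * D ρ
      - (y * y * γ + 2 * y * (D γ + γ)) * ρ = 0)
    (σ1 σ2 σ3 τ : R) (h1 : σ1 = 2 * D ρ - y * ρ) (h2 : σ2 = 2 * D σ1 - 4 * σ1 - y * σ1)
    (h3 : σ3 = 2 * D σ2 - 8 * σ2 - y * σ2)
    (hτ : τ = 3 * n * y * σ3 - 4 * (1 - y * γ) * σ1 + 4 * y * (D γ + γ - 1) * ρ) :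
    6 * (y * y) * φ τ + 3 * (y * y) * τ + (2 - 3 * y + y * γ) * (2 * D τ - 4 * τ + y * τ)
      + 4 * y * (D γ + γ - 1) * τ = 0 := by
  have num : ∀ (d : Derivation ℚ R R) (k : ℕ) [k.AtLeastTwo], d (OfNat.ofNat k : R) = 0 := by
    intro d k _
    exact_mod_cast d.map_natCast k
  have φDγ : φ (D γ) = 0 := by rw [com, φγ]; simp
  have hPI1 := congrArg D hPI
  have hE1 := congrArg D hE
  simp only [map_add, map_sub, map_neg, map_zero, Derivation.leibniz, smul_eq_mul, num,
    Derivation.map_one_eq_zero, Dy, Dn, mul_zero, add_zero, sub_zero] at hPI1 hE1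
  have hPI2 := congrArg D hPI1
  have hE2 := congrArg D hE1
  simp only [map_add, map_sub, map_neg, map_zero, Derivation.leibniz, smul_eq_mul, num,
    Derivation.map_one_eq_zero, Dy, Dn, mul_zero, add_zero, sub_zero] at hPI2 hE2
  have hE3 := congrArg D hE2
  simp only [map_add, map_sub, map_neg, map_zero, Derivation.leibniz, smul_eq_mul, num,
    Derivation.map_one_eq_zero, Dy, Dn, mul_zero, add_zero, sub_zero] at hE3
  subst h1
  simp only [map_add, map_sub, map_neg, map_zero, Derivation.leibniz, smul_eq_mul, num,
    Derivation.map_one_eq_zero, Dy, Dn, mul_zero, add_zero, sub_zero] at h2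
  subst h2
  simp only [map_add, map_sub, map_neg, map_zero, Derivation.leibniz, smul_eq_mul, num,
    Derivation.map_one_eq_zero, Dy, Dn, mul_zero, add_zero, sub_zero] at h3
  subst h3
  subst hτ
  simp only [map_add, map_sub, map_neg, map_zero, Derivation.leibniz, smul_eq_mul, num,
    Derivation.map_one_eq_zero, Dy, Dn, mul_zero, add_zero, sub_zero, com, φγ, φn, φy, φDγ]
  linear_combination (24 * y * n) * hE3 + (-288 * y * n + 36 * y ^ 2 * n) * hE2
    + (-8 + 8 * y * γ + 1056 * y * n - 252 * y ^ 2 * n - 18 * y ^ 3 * n) * hE1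
    + (16 - 8 * y + 4 * y * D γ - 12 * y * γ - 1152 * y * n + 4 * y ^ 2 * γ + 396 * y ^ 2 * n
        + 54 * y ^ 3 * n + 9 * y ^ 4 * n) * hE
    + (12 * y ^ 2 * ρ) * hPI2 + (24 * y ^ 2 * D ρ + 24 * y ^ 2 * ρ - 12 * y ^ 3 * ρ) * hPI1
    + (48 * y ^ 2 * D ρ - 24 * y ^ 3 * ρ) * hPI

end

section


lemma cf_one (g d) : cf g d (1 : B) = if g = 0 ∧ d = 0 then 1 else 0 := by
  simp only [cf, PowerSeries.coeff_one]
  by_cases hg : g = 0 <;> simp [hg, PowerSeries.coeff_one]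

lemma cf_yy (g d) : cf g d yy = if g = 0 ∧ d = 1 then 1 else 0 := by
  rw [← mul_one yy]
  cases d <;> simp only [cf_yy_zero, cf_yy_succ, cf_one] <;> simp

lemma cf_ee (g d) : cf g d ee = if g = 1 ∧ d = 0 then 1 else 0 := by
  rw [← mul_one ee]
  cases g <;> simp only [cf_ee_zero, cf_ee_succ, cf_one] <;> simp

@[simp] lemma cf_mul2 (g d : ℕ) (f : B) : cf g d ((2 : B) * f) = 2 * cf g d f := by
  rw [← cf_smul, Algebra.smul_def, map_ofNat]
@[simp] lemma cf_mul3 (g d : ℕ) (f : B) : cf g d ((3 : B) * f) = 3 * cf g d f := by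
  rw [← cf_smul, Algebra.smul_def, map_ofNat]
@[simp] lemma cf_mul4 (g d : ℕ) (f : B) : cf g d ((4 : B) * f) = 4 * cf g d f := by
  rw [← cf_smul, Algebra.smul_def, map_ofNat]
@[simp] lemma cf_mul5 (g d : ℕ) (f : B) : cf g d ((5 : B) * f) = 5 * cf g d f := by
  rw [← cf_smul, Algebra.smul_def, map_ofNat]
@[simp] lemma cf_mul6 (g d : ℕ) (f : B) : cf g d ((6 : B) * f) = 6 * cf g d f := by
  rw [← cf_smul, Algebra.smul_def, map_ofNat]
@[simp] lemma cf_mul8 (g d : ℕ) (f : B) : cf g d ((8 : B) * f) = 8 * cf g d f := by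
  rw [← cf_smul, Algebra.smul_def, map_ofNat]

/-- series depending on `η` only -/
def con (u : ℕ → ℚ) : B := arr fun g d => if d = 0 then u g else 0

lemma cf_con_mul (g d u) (f : B) : cf g d (con u * f) =
    ∑ p ∈ Finset.HasAntidiagonal.antidiagonal g, u p.1 * cf p.2 d f := by
  rw [cf_mul]
  refine Finset.sum_congr rfl fun p hp => ?_
  rw [Finset.sum_eq_single (0, d)]
  · simp [con]
  · rintro ⟨a, b⟩ h1 h2
    have : a ≠ 0 := by
      rintro rfl
      rw [Finset.HasAntidiagonal.mem_antidiagonal] at h1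
      simp at h1; subst h1; simp at h2
    simp [con, this]
  · intro h; exact absurd (by simp) h

lemma cf_con (g d u) : cf g d (con u) = if d = 0 then u g else 0 := by simp [con]

/-- the derivation `φ = M ∂_M` -/
def dphi : Derivation ℚ B B := wt 0 (-1)
/-- the derivation `θ = s ∂_s` -/
def dthe : Derivation ℚ B B := wt (-5) 1
/-- the derivation `D = θ + y φ` -/
def dD : Derivation ℚ B B := dthe + yy • dphi

lemma dD_apply (f : B) : dD f = dthe f + yy * dphi f := by simp [dD]
lemma cf_dphi (g d : ℕ) (f : B) : cf g d (dphi f) = -d * cf g d f := by simp [dphi]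
lemma cf_dthe (g d : ℕ) (f : B) : cf g d (dthe f) = (-5 * g + d) * cf g d f := by simp [dthe]

lemma dphi_yy : dphi yy = - yy := by
  apply cf_ext; intro g d; rw [cf_dphi, cf_neg, cf_yy]; split_ifs with h <;> simp [h]
lemma dphi_ee : dphi ee = 0 := by
  apply cf_ext; intro g d; rw [cf_dphi, cf_zero, cf_ee]; split_ifs with h <;> simp [h]
lemma dthe_yy : dthe yy = yy := by
  apply cf_ext; intro g d; rw [cf_dthe, cf_yy]; split_ifs with h <;> simp [h]
lemma dthe_ee : dthe ee = -5 * ee := by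
  apply cf_ext; intro g d
  rw [neg_mul, cf_neg, cf_mul5, cf_dthe, cf_ee]; split_ifs with h <;> simp [h]
lemma dphi_con (u) : dphi (con u) = 0 := by
  apply cf_ext; intro g d; rw [cf_dphi, cf_zero, cf_con]; split_ifs with h <;> simp [h]
lemma dthe_con (u) : dthe (con u) = con fun g => -5 * g * u g := by
  apply cf_ext; intro g d; rw [cf_dthe, cf_con, cf_con]; split_ifs with h <;> simp [h]
lemma dD_con (u) : dD (con u) = con fun g => -5 * g * u g := by
  rw [dD_apply, dphi_con, dthe_con]; simp
lemma dcom (f : B) : dphi (dD f) = dD (dphi f) - yy * dphi f := by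
  rw [dD_apply, dD_apply, map_add, Derivation.leibniz, dphi_yy]
  have : dphi (dthe f) = dthe (dphi f) := by
    apply cf_ext; intro g d; simp only [cf_dphi, cf_dthe]; ring
  rw [this]; simp only [smul_eq_mul]; ring
lemma dD_yy : dD yy = yy - yy * yy := by rw [dD_apply, dphi_yy, dthe_yy]; ring
lemma dD_ee : dD ee = -5 * ee := by rw [dD_apply, dphi_ee, dthe_ee]; ring

/-- the two-index coefficient array of the resolvent -/
def aa (c : ℕ → ℚ) : ℕ → ℕ → ℚ
  | 0, d => if d = 0 then 1 else 0
  | _ + 1, 0 => 0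
  | g + 1, d + 1 => if 3 * (g + 1) < d + 1 then 0 else
      ((15 * (g + 1) - 5 * d) * aa c (g + 1) d - ∑ i : Fin (g + 1), c (g + 1 - i) *
        ((10 * (i : ℕ) - 5 * (g + 1) - d + 1) * aa c i d +
          (d - 1 / 2) * (if d = 0 then 0 else aa c i (d - 1)))) / (2 * (5 * (g + 1) - d - 1))
termination_by g d => (g, d)
decreasing_by
  all_goals simp_wf
  all_goals first
    | (apply Prod.Lex.left; omega)
    | (apply Prod.Lex.right; omega)

lemma aa_zero (c : ℕ → ℚ) (d : ℕ) : aa c 0 d = if d = 0 then 1 else 0 := by rw [aa]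
lemma aa_succ_zero (c : ℕ → ℚ) (g : ℕ) : aa c (g + 1) 0 = 0 := by rw [aa]
lemma aa_supp (c : ℕ → ℚ) (g d : ℕ) (h : 3 * g < d) : aa c g d = 0 := by
  cases g with
  | zero => rw [aa_zero]; simp; omega
  | succ g =>
    cases d with
    | zero => rw [aa]
    | succ d => rw [aa]; simp [h]

lemma aa_rec (c : ℕ → ℚ) (g d : ℕ) :
    2 * (5 * ((g : ℚ) + 1) - d - 1) * aa c (g + 1) (d + 1) =
      (15 * ((g : ℚ) + 1) - 5 * d) * aa c (g + 1) d - ∑ i ∈ Finset.range (g + 1), c (g + 1 - i) *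
        ((10 * (i : ℚ) - 5 * ((g : ℚ) + 1) - d + 1) * aa c i d +
          (d - 1 / 2) * (if d = 0 then 0 else aa c i (d - 1))) := by
  rw [← Fin.sum_univ_eq_sum_range (fun i => c (g + 1 - i) *
        ((10 * (i : ℚ) - 5 * ((g : ℚ) + 1) - d + 1) * aa c i d +
          (d - 1 / 2) * (if d = 0 then 0 else aa c i (d - 1)))) (g + 1)]
  by_cases h : 3 * (g + 1) < d + 1
  · rw [aa_supp c (g + 1) (d + 1) h, Finset.sum_eq_zero]
    · by_cases h' : d = 3 * (g + 1)
      · subst h'; push_cast; ring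
      · rw [aa_supp c (g+1) d (by omega)]; simp
    · intro i _
      have := i.2
      rw [aa_supp c i d (by omega), aa_supp c i (d-1) (by omega)]; simp
  · rw [aa, if_neg h]
    have : (5 * ((g : ℚ) + 1) - d - 1) ≠ 0 := by
      have h2 : ((d : ℚ) + 1) ≤ 3 * (g + 1) := by exact_mod_cast (not_lt.mp h)
      have : (0:ℚ) ≤ g := by positivity
      intro h3; linarith
    field_simp

variable (c : ℕ → ℚ)

/-- `γ` -/
def gam : ℕ → ℚ := fun h => if h = 0 then 0 else c h

/-- the resolvent -/
def rho : B := arr (aa c)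

lemma hE_the : 2 * dthe (rho c) + yy * (2 * dphi (rho c) - 3 * dthe (rho c)
    + con (gam c) * (dthe (rho c) + yy * (dphi (rho c) - (1 / 2 : ℚ) • rho c))
    - con (fun g => (1 - 5 * g) * gam c g) * rho c) = 0 := by
  apply cf_ext
  intro g d
  cases d with
  | zero =>
    simp only [cf_add, cf_yy_zero, cf_mul2, cf_mul3, cf_mul4, cf_mul5, cf_mul6, cf_mul8, cf_zero, cf_dthe, rho, cf_arr]
    cases g with
    | zero => simp
    | succ g => simp [aa_succ_zero]
  | succ d =>
    simp only [cf_add, cf_sub, cf_yy_succ, cf_mul2, cf_mul3, cf_mul4, cf_mul5, cf_mul6, cf_mul8, cf_zero, cf_dthe, cf_dphi, cf_con_mul]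
    rw [add_sub_assoc, ← Finset.sum_sub_distrib,
      Finset.Nat.sum_antidiagonal_eq_sum_range_succ_mk, Finset.sum_range_succ']
    simp only [gam, if_true, zero_mul, mul_zero, sub_zero, add_zero]
    cases g with
    | zero => 
      simp [rho, aa_zero]
      by_cases hd : d = 0 <;> simp [hd]
    | succ g =>
      have h := aa_rec c g d
      rw [← Finset.sum_range_reflect] at h
      have h2 : ∑ k ∈ Finset.range (g + 1),
        ((if k + 1 = 0 then 0 else c (k + 1)) * ((-5 * ((g + 1 - (k + 1) : ℕ) : ℚ) + d) * cf (g + 1 - (k + 1)) d (rho c)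
          + cf (g + 1 - (k + 1)) d (yy * (dphi (rho c) - (1 / 2 : ℚ) • rho c)))
          - (1 - 5 * ((k + 1 : ℕ) : ℚ)) * (if k + 1 = 0 then 0 else c (k + 1)) * cf (g + 1 - (k + 1)) d (rho c))
        = ∑ j ∈ Finset.range (g + 1), - (c (g + 1 - (g + 1 - 1 - j)) *
        ((10 * ((g + 1 - 1 - j : ℕ) : ℚ) - 5 * ((g : ℚ) + 1) - d + 1) * aa c (g + 1 - 1 - j) d +
          (d - 1 / 2) * (if d = 0 then 0 else aa c (g + 1 - 1 - j) (d - 1)))) := by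
        refine Finset.sum_congr rfl fun k hk => ?_
        rw [Finset.mem_range] at hk
        have e1 : g + 1 - (k + 1) = g - k := by omega
        have e2 : g + 1 - 1 - k = g - k := by omega
        have e3 : g + 1 - (g - k) = k + 1 := by omega
        have e4 : ((g - k : ℕ) : ℚ) = (g : ℚ) - k := by rw [Nat.cast_sub (by omega)]
        rw [e1, e2, e3, e4]
        simp only [Nat.succ_ne_zero, if_false, rho, cf_arr]
        cases d with
        | zero => simp; ring
        | succ d =>
          simp only [cf_yy_succ, cf_sub, cf_smul, cf_dphi, cf_arr, Nat.succ_ne_zero, if_false,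
            Nat.add_sub_cancel]
          push_cast; ring
      rw [h2, Finset.sum_neg_distrib]
      simp only [rho, cf_arr]
      push_cast at h ⊢
      linarith

end

section


lemma con_add (u v : ℕ → ℚ) : con u + con v = con (fun g => u g + v g) := by
  apply cf_ext; intro g d; simp only [cf_add, cf_con]; split_ifs <;> simp

lemma hPI_of (c : ℕ → ℚ) (h0 : c 0 = -1)
    (hc : ∀ n : ℕ, 4 * (25 * (n : ℚ) ^ 2 - 1) * c n +
      ∑ p ∈ Finset.HasAntidiagonal.antidiagonal (n + 1), c p.1 * c p.2 = 0) :
    4 * ee * (dD (dD (con (gam c))) - (con (gam c) - 1)) + (con (gam c) - 1) * (con (gam c) - 1) - 1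
      = 0 := by
  have e : con (gam c) - 1 = con c := by
    apply cf_ext; intro g d
    rw [cf_sub, cf_con, cf_con, cf_one]
    by_cases hd : d = 0 <;> by_cases hg : g = 0 <;> simp [hd, hg, gam, h0]
  rw [e, dD_con, dD_con]
  apply cf_ext; intro g d
  rw [mul_assoc]
  simp only [cf_sub, cf_add, cf_mul4, cf_one, cf_con_mul, cf_con, cf_zero]
  by_cases hd : d = 0
  · subst hd
    cases g with
    | zero => simp [h0]
    | succ n =>
      have := hc n
      simp only [cf_ee_succ, cf_sub, cf_con, if_true]
      simp only [gam]
      by_cases hn : n = 0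
      · subst hn; simp at this ⊢; linarith
      · simp [hn]; linarith
  · simp only [hd, if_false]
    cases g <;> simp [cf_con, hd]

/-- support condition -/
def Supp (m : ℤ) (f : B) : Prop := ∀ g d : ℕ, (3 * g + m : ℤ) < d → cf g d f = 0

lemma Supp.add {m f f'} (h : Supp m f) (h' : Supp m f') : Supp m (f + f') := by
  intro g d hd; rw [cf_add, h g d hd, h' g d hd, add_zero]
lemma Supp.sub {m f f'} (h : Supp m f) (h' : Supp m f') : Supp m (f - f') := by
  intro g d hd; rw [cf_sub, h g d hd, h' g d hd, sub_zero]
lemma Supp.mono {m n f} (h : Supp m f) (hn : m ≤ n) : Supp n f := by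
  intro g d hd; exact h g d (by omega)
lemma Supp.mul {m n f f'} (h : Supp m f) (h' : Supp n f') : Supp (m + n) (f * f') := by
  intro g d hd
  rw [cf_mul]
  refine Finset.sum_eq_zero fun p hp => Finset.sum_eq_zero fun q hq => ?_
  rw [Finset.HasAntidiagonal.mem_antidiagonal] at hp hq
  by_cases h1 : (3 * p.1 + m : ℤ) < q.1
  · rw [h _ _ h1, zero_mul]
  · rw [h' p.2 q.2 (by omega), mul_zero]
lemma Supp.wt {m f} (h : Supp m f) (α β) : Supp m (wt α β f) := by
  intro g d hd; rw [cf_wt, h g d hd, mul_zero]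
lemma supp_yy : Supp 1 yy := by
  intro g d hd; rw [cf_yy, if_neg (by omega)]
lemma supp_ee : Supp (-3) ee := by
  intro g d hd; rw [cf_ee, if_neg (by omega)]
lemma supp_one : Supp 0 1 := by
  intro g d hd; rw [cf_one, if_neg (by omega)]
lemma supp_con {u : ℕ → ℚ} (h : u 0 = 0) : Supp (-3) (con u) := by
  intro g d hd; rw [cf_con]; split_ifs with hd'
  · have : g = 0 := by omega
    rw [this, h]
  · rfl
lemma Supp.nat {m f} (k : ℕ) (h : Supp m f) : Supp m ((k : B) * f) := by
  intro g d hd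
  have : (k : B) * f = (k : ℚ) • f := by rw [Algebra.smul_def, map_natCast]
  rw [this, cf_smul, h g d hd, mul_zero]
lemma Supp.dD {m f} (h : Supp m f) : Supp (m + 1) (dD f) := by
  rw [dD_apply]
  exact (Supp.mono (h.wt _ _) (by omega)).add (Supp.mono (supp_yy.mul (h.wt _ _)) (by omega))

/-- twisted derivative step -/
def stp (k : ℕ) (f : B) : B := 2 * dD f - (k : B) * f - yy * f

lemma Supp.stp {m f} (h : Supp m f) (k) : Supp (m + 1) (stp k f) := by
  unfold WittenAsym.stp
  refine ((Supp.nat 2 h.dD).sub ((h.nat k).mono (by omega))).sub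
    ((supp_yy.mul h).mono (by omega))

lemma cf_stp_top (k : ℕ) (f : B) (g d : ℕ) (h : cf g (d + 1) f = 0) :
    cf g (d + 1) (stp k f) = -(2 * d + 1) * cf g d f := by
  have : (k : B) * f = (k : ℚ) • f := by rw [Algebra.smul_def, map_natCast]
  rw [stp, this, dD_apply]
  simp only [cf_sub, cf_add, cf_mul2, cf_yy_succ, cf_smul, h, cf_dthe, cf_dphi]
  ring

variable (c : ℕ → ℚ)

def sig1 : B := stp 0 (rho c)
def sig2 : B := stp 4 (sig1 c)
def sig3 : B := stp 8 (sig2 c)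
def tau : B := 3 * ee * yy * sig3 c - 4 * (1 - yy * con (gam c)) * sig1 c
    + 4 * yy * (dD (con (gam c)) + con (gam c) - 1) * rho c

lemma supp_rho : Supp 0 (rho c) := by
  intro g d hd; rw [rho, cf_arr, aa_supp]; omega

lemma supp_sig1 : Supp 1 (sig1 c) := (supp_rho c).stp 0
lemma supp_sig2 : Supp 2 (sig2 c) := (supp_sig1 c).stp 4
lemma supp_sig3 : Supp 3 (sig3 c) := (supp_sig2 c).stp 8

lemma gam_zero : gam c 0 = 0 := by simp [gam]

lemma supp_tau : Supp 1 (tau c) := by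
  have hg : Supp (-3) (con (gam c)) := supp_con (gam_zero c)
  have hg' : Supp (-3) (dD (con (gam c))) := by
    rw [dD_con]; exact supp_con (by simp)
  have h3 : Supp 1 (ee * yy * sig3 c) := ((supp_ee.mul supp_yy).mul (supp_sig3 c)).mono (by omega)
  have h1 : Supp 1 ((1 - yy * con (gam c)) * sig1 c) :=
    ((supp_one.sub ((supp_yy.mul hg).mono (by omega))).mul (supp_sig1 c)).mono (by omega)
  have h0 : Supp 1 (yy * (dD (con (gam c)) + con (gam c) - 1) * rho c) :=
    ((supp_yy.mul (((hg'.add hg).mono (by omega)).sub supp_one)).mul (supp_rho c)).mono (by omega)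
  have := ((h3.nat 3).sub (h1.nat 4)).add (h0.nat 4)
  convert this using 1
  rw [tau]; push_cast; ring

lemma hE_D : 6 * (yy * yy) * dphi (rho c) + 2 * (2 - 3 * yy + yy * con (gam c)) * dD (rho c)
      - (yy * yy * con (gam c) + 2 * yy * (dD (con (gam c)) + con (gam c))) * rho c = 0 := by
  have h := hE_the c
  have e : dD (con (gam c)) + con (gam c) = con (fun g => (1 - 5 * g) * gam c g) := by
    rw [dD_con, con_add]; congr 1; ext g; ring
  have half : (2 : B) * ((1 / 2 : ℚ) • rho c) = rho c := by
    rw [two_mul, ← add_smul]; norm_num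
  rw [e, dD_apply]
  linear_combination 2 * h + yy * con (gam c) * yy * half

lemma cf_con_mul_eq_zero {u : ℕ → ℚ} (hu : u 0 = 0) (f : B) (g : ℕ)
    (hf : ∀ i < g, ∀ d, cf i d f = 0) (d : ℕ) : cf g d (con u * f) = 0 := by
  rw [cf_con_mul]
  refine Finset.sum_eq_zero fun p hp => ?_
  rw [Finset.HasAntidiagonal.mem_antidiagonal] at hp
  by_cases h : p.1 = 0
  · rw [h, hu, zero_mul]
  · rw [hf p.2 (by omega), mul_zero]

lemma tau_eq (h0 : c 0 = -1)
    (hc : ∀ n : ℕ, 4 * (25 * (n : ℚ) ^ 2 - 1) * c n +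
      ∑ p ∈ Finset.HasAntidiagonal.antidiagonal (n + 1), c p.1 * c p.2 = 0) : tau c = 0 := by
  have key := alg_identity dD dphi yy ee (con (gam c)) (rho c) dD_yy dphi_yy dD_ee dphi_ee
    (dphi_con _) dcom (hPI_of c h0 hc) (hE_D c) (sig1 c) (sig2 c) (sig3 c) (tau c)
    (by simp [sig1, stp]) (by simp [sig2, stp]) (by simp [sig3, stp]) rfl
  have e : dD (con (gam c)) + con (gam c) = con (fun g => (1 - 5 * g) * gam c g) := by
    rw [dD_con, con_add]; congr 1; ext g; ring
  have key2 : 4 * (dthe (tau c) - 2 * tau c) + yy * (4 * dphi (tau c) + 4 * tau c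
      - 6 * dthe (tau c) + 6 * tau c
      + con (gam c) * (2 * dthe (tau c) + yy * (2 * dphi (tau c) + tau c) - 4 * tau c)
      + con (fun g => (1 - 5 * g) * gam c g) * (4 * tau c)) = 0 := by
    rw [e, dD_apply] at key
    linear_combination key
  apply cf_ext
  intro g
  induction g using Nat.strong_induction_on with
  | _ g ih =>
    simp only [cf_zero] at ih ⊢
    have hz1 := cf_con_mul_eq_zero (gam_zero c)
      (2 * dthe (tau c) + yy * (2 * dphi (tau c) + tau c) - 4 * tau c) g (by
        intro i hi d
        cases d <;> simp [cf_dthe, cf_dphi, ih i hi])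
    have hz2 := cf_con_mul_eq_zero (u := fun g => (1 - 5 * g) * gam c g) (by simp [gam])
      (4 * tau c) g (by
        intro i hi d
        simp [ih i hi])
    intro d
    by_cases hd : 5 * g + 1 < d
    · exact supp_tau c g d (by omega)
    · induction d with
      | zero =>
        have := congrArg (cf g 0) key2
        simp only [cf_add, cf_sub, cf_mul2, cf_mul4, cf_yy_zero, cf_zero, cf_dthe] at this
        have h5 : (0 : ℚ) ≤ g := by positivity
        have : (-5 * (g : ℚ) - 2) * cf g 0 (tau c) = 0 := by push_cast at this; linarith
        rcases mul_eq_zero.mp this with h | h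
        · linarith
        · exact h
      | succ d ihd =>
        have ihd := ihd (by omega)
        have := congrArg (cf g (d + 1)) key2
        simp only [cf_add, cf_sub, cf_mul2, cf_mul4, cf_mul6, cf_yy_succ, cf_zero, cf_dthe,
          cf_dphi, hz1, hz2, ihd] at this
        have h5 : (d : ℚ) + 1 ≤ 5 * g + 1 := by exact_mod_cast (not_lt.mp hd)
        have : (-5 * (g : ℚ) + d + 1 - 2) * cf g (d + 1) (tau c) = 0 := by
          push_cast at this; linarith
        rcases mul_eq_zero.mp this with h | h
        · linarith
        · exact h

lemma aa_top_rec (h0 : c 0 = -1)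
    (hc : ∀ n : ℕ, 4 * (25 * (n : ℚ) ^ 2 - 1) * c n +
      ∑ p ∈ Finset.HasAntidiagonal.antidiagonal (n + 1), c p.1 * c p.2 = 0) (g : ℕ) :
    8 * ((g : ℚ) + 1) * aa c (g + 1) (3 * (g + 1)) =
      (6 * g + 1) * (6 * g + 3) * (6 * g + 5) * aa c g (3 * g) := by
  have h := congrArg (cf (g + 1) (3 * (g + 1) + 1)) (tau_eq c h0 hc)
  have hg : Supp (-3) (con (gam c)) := supp_con (gam_zero c)
  have hg' : Supp (-3) (dD (con (gam c))) := by
    rw [dD_con]; exact supp_con (by simp)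
  have e : tau c = 3 * (ee * (yy * sig3 c)) - 4 * sig1 c + 4 * (yy * (con (gam c) * sig1 c))
    + 4 * (yy * ((dD (con (gam c)) + con (gam c)) * rho c)) - 4 * (yy * rho c) := by
    rw [tau]; ring
  rw [e] at h
  simp only [cf_add, cf_sub, cf_mul3, cf_mul4, cf_ee_succ, cf_yy_succ, cf_zero] at h
  rw [(hg.mul (supp_sig1 c)) _ _ (by push_cast; omega),
    ((hg'.add hg).mul (supp_rho c)) _ _ (by push_cast; omega)] at h
  have s3 : cf g (3 * g + 2 + 1) (sig3 c) = -(2 * (3 * g + 2 : ℕ) + 1) * cf g (3 * g + 2) (sig2 c) :=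
    cf_stp_top _ _ _ _ (supp_sig2 c _ _ (by push_cast; omega))
  have s2 : cf g (3 * g + 1 + 1) (sig2 c) = -(2 * (3 * g + 1 : ℕ) + 1) * cf g (3 * g + 1) (sig1 c) :=
    cf_stp_top _ _ _ _ (supp_sig1 c _ _ (by push_cast; omega))
  have s1 : cf g (3 * g + 1) (sig1 c) = -(2 * (3 * g : ℕ) + 1) * cf g (3 * g) (rho c) :=
    cf_stp_top _ _ _ _ (supp_rho c _ _ (by push_cast; omega))
  have s0 : cf (g + 1) (3 * (g + 1) + 1) (sig1 c)
      = -(2 * (3 * (g + 1) : ℕ) + 1) * cf (g + 1) (3 * (g + 1)) (rho c) :=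
    cf_stp_top _ _ _ _ (supp_rho c _ _ (by push_cast; omega))
  have e3 : cf g (3 * (g + 1)) (sig3 c) = cf g (3 * g + 2 + 1) (sig3 c) := by congr 1
  rw [e3, s3, s2, s1, s0] at h
  simp only [rho, cf_arr] at h
  push_cast at h
  linear_combination (1/3 : ℚ) * h

/-- closed form of the top coefficient -/
lemma aa_top (h0 : c 0 = -1)
    (hc : ∀ n : ℕ, 4 * (25 * (n : ℚ) ^ 2 - 1) * c n +
      ∑ p ∈ Finset.HasAntidiagonal.antidiagonal (n + 1), c p.1 * c p.2 = 0) (g : ℕ) :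
    aa c g (3 * g) * (64 ^ g * (3 * g).factorial * g.factorial) = (6 * g).factorial := by
  induction g with
  | zero => simp [aa_zero]
  | succ g ih =>
    have h := aa_top_rec c h0 hc g
    have e6 : (6 * (g + 1)).factorial = (6*g+6)*(6*g+5)*(6*g+4)*(6*g+3)*(6*g+2)*(6*g+1)*(6*g).factorial := by
      rw [show 6 * (g + 1) = 6*g+5+1 by ring]
      simp only [Nat.factorial_succ]; ring
    have e3 : (3 * (g + 1)).factorial = (3*g+3)*(3*g+2)*(3*g+1)*(3*g).factorial := by
      rw [show 3 * (g + 1) = 3*g+2+1 by ring]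
      simp only [Nat.factorial_succ]; ring
    rw [e6, e3, Nat.factorial_succ g]
    push_cast
    rw [← ih, pow_succ]
    linear_combination (8 * (3*g+3)*(3*g+2)*(3*g+1) * 64 ^ g * ((3 * g).factorial : ℚ) * g.factorial) * h

end

section


lemma fact_mul_le (i j : ℕ) (hj : 1 ≤ j) : (i + 1 + j) * ((i + 1).factorial * j.factorial) ≤ (i + 1 + j).factorial := by
  induction i with
  | zero => simp [Nat.factorial_succ, add_comm]
  | succ i ih =>
    have e : (i + 1 + 1 + j).factorial = (i + 1 + 1 + j) * (i + 1 + j).factorial := by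
      rw [show i + 1 + 1 + j = (i + 1 + j) + 1 by ring, Nat.factorial_succ]
    rw [e, Nat.factorial_succ (i + 1)]
    apply Nat.mul_le_mul_left
    refine le_trans ?_ ih
    rw [mul_assoc]
    apply Nat.mul_le_mul_right
    omega

/-- the hypotheses on `c` -/
structure IsC (c : ℕ → ℚ) : Prop where
  h0 : c 0 = -1
  h1 : c 1 = 2
  h2 : c 2 = 98
  hrec : ∀ g : ℕ, 3 ≤ g →
      c g = 50 * ((g : ℚ) - 1) ^ 2 * c (g - 1) +
        (1 / 2) * ∑ h ∈ Finset.Icc 2 (g - 2), c h * c (g - h)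


lemma sum_split {c : ℕ → ℚ} (H : IsC c) (g : ℕ) (hg : 3 ≤ g) :
    ∑ i ∈ Finset.range (g - 1), c (i + 1) * c (g - (i + 1)) =
      4 * c (g - 1) + ∑ h ∈ Finset.Icc 2 (g - 2), c h * c (g - h) := by
  obtain ⟨k, rfl⟩ : ∃ k, g = k + 3 := ⟨g - 3, by omega⟩
  have e1 : k + 3 - 1 = k + 1 + 1 := by omega
  rw [e1, Finset.sum_range_succ, Finset.sum_range_succ']
  have e2 : Finset.Icc 2 (k + 3 - 2) = Finset.Ico 2 (k + 2) := by
    ext x; simp; omega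
  rw [e2, Finset.sum_Ico_eq_sum_range]
  have e3 : k + 2 - 2 = k := by omega
  rw [e3]
  have e4 : k + 3 - (k + 1 + 1) = 1 := by omega
  rw [e4]
  simp only [H.h1, zero_add]
  have e5 : k + 3 - 1 = k + 2 := by omega
  rw [e5]
  have : ∑ i ∈ Finset.range k, c (i + 1 + 1) * c (k + 3 - (i + 1 + 1))
     = ∑ i ∈ Finset.range k, c (2 + i) * c (k + 3 - (2 + i)) := by
    refine Finset.sum_congr rfl fun i _ => ?_
    rw [show i + 1 + 1 = 2 + i by ring]
  rw [this]; ring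

lemma c_conv {c : ℕ → ℚ} (H : IsC c) (n : ℕ) : 4 * (25 * (n : ℚ) ^ 2 - 1) * c n +
      ∑ p ∈ Finset.HasAntidiagonal.antidiagonal (n + 1), c p.1 * c p.2 = 0 := by
  rw [Finset.Nat.sum_antidiagonal_eq_sum_range_succ_mk, Finset.sum_range_succ, Finset.sum_range_succ']
  simp only [Nat.sub_self, Nat.sub_zero, H.h0]
  rcases n with _ | _ | n
  · simp [H.h0, H.h1]; norm_num
  · simp [H.h1, H.h2, Finset.sum_range_succ]; norm_num
  · have h := H.hrec (n + 1 + 1 + 1) (by omega)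
    have h' := sum_split H (n + 1 + 1 + 1) (by omega)
    rw [show n + 1 + 1 + 1 - 1 = n + 1 + 1 by omega] at h h'
    rw [h', h]; push_cast; ring

lemma c_bounds {c : ℕ → ℚ} (H : IsC c) (g : ℕ) (hg : 1 ≤ g) :
    (1 / 50 : ℚ) * (50 ^ g * ((g - 1).factorial : ℚ) ^ 2) ≤ c g ∧
    c g ≤ (1 / 10) * (1 - 1 / (g + 1)) * (50 ^ g * ((g - 1).factorial : ℚ) ^ 2) := by
  induction g using Nat.strong_induction_on with
  | _ g ih =>
    obtain rfl | rfl | h3 : g = 1 ∨ g = 2 ∨ 3 ≤ g := by omega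
    · rw [H.h1]; norm_num
    · rw [H.h2]; norm_num
    obtain ⟨k, rfl⟩ : ∃ k, g = k + 3 := ⟨g - 3, by omega⟩
    have hr := H.hrec (k + 3) (by omega)
    obtain ⟨l1, u1⟩ := ih (k + 2) (by omega) (by omega)
    have pos : ∀ h, 1 ≤ h → h < k + 3 → 0 ≤ c h := fun h h1 h2 =>
      le_trans (by positivity) (ih h h2 h1).1
    have up : ∀ h, 1 ≤ h → h < k + 3 → c h ≤ (1 / 10) * (50 ^ h * ((h - 1).factorial : ℚ) ^ 2) := by
      intro h h1 h2
      refine le_trans (ih h h2 h1).2 ?_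
      have : (1 / 10 : ℚ) * (1 - 1 / (h + 1)) ≤ 1 / 10 := by
        have : (0 : ℚ) ≤ 1 / (h + 1) := by positivity
        linarith
      gcongr
    have e1 : k + 3 - 1 = k + 2 := by omega
    have e2 : k + 3 - 2 = k + 1 := by omega
    have e3 : k + 2 - 1 = k + 1 := by omega
    rw [e1, e2] at hr
    rw [e1]
    rw [e3] at l1 u1
    have hs0 : 0 ≤ ∑ h ∈ Finset.Icc 2 (k + 1), c h * c (k + 3 - h) := by
      refine Finset.sum_nonneg fun h hh => ?_
      rw [Finset.mem_Icc] at hh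
      exact mul_nonneg (pos _ (by omega) (by omega)) (pos _ (by omega) (by omega))
    have hs1 : ∑ h ∈ Finset.Icc 2 (k + 1), c h * c (k + 3 - h) ≤
        k * ((1 / 100) * 50 ^ (k + 3) * (((k + 1).factorial : ℚ) / (k + 1)) ^ 2) := by
      have : (k : ℚ) = ((Finset.Icc 2 (k + 1)).card : ℚ) := by simp
      rw [this, ← nsmul_eq_mul]
      refine Finset.sum_le_card_nsmul _ _ _ fun h hh => ?_
      rw [Finset.mem_Icc] at hh
      have u2 := up h (by omega) (by omega)
      have u3 := up (k + 3 - h) (by omega) (by omega)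
      obtain ⟨i, rfl⟩ : ∃ i, h = i + 2 := ⟨h - 2, by omega⟩
      obtain ⟨j, hj⟩ : ∃ j, k + 3 - (i + 2) = j + 2 := ⟨k + 3 - (i + 2) - 2, by omega⟩
      have hk : k + 1 = i + 1 + (j + 1) := by omega
      have hf := fact_mul_le i (j + 1) (by omega)
      rw [hj] at u3 ⊢
      rw [show i + 2 - 1 = i + 1 by omega] at u2
      rw [show j + 2 - 1 = j + 1 by omega] at u3
      have hf' : ((i + 1).factorial : ℚ) * (j + 1).factorial ≤ ((k + 1).factorial : ℚ) / (k + 1) := by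
        rw [le_div_iff₀ (by positivity)]
        rw [← hk] at hf
        have : (((k + 1) * ((i + 1).factorial * (j + 1).factorial) : ℕ) : ℚ) ≤ ((k + 1).factorial : ℕ) := by
          exact_mod_cast hf
        push_cast at this
        linarith
      calc c (i + 2) * c (j + 2) ≤ ((1 / 10) * (50 ^ (i + 2) * ((i + 1).factorial : ℚ) ^ 2)) *
            ((1 / 10) * (50 ^ (j + 2) * ((j + 1).factorial : ℚ) ^ 2)) := by
            apply mul_le_mul u2 u3 (by rw [← hj]; exact pos _ (by omega) (by omega)) (by positivity)
        _ = (1 / 100) * 50 ^ (k + 3) * (((i + 1).factorial : ℚ) * (j + 1).factorial) ^ 2 := by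
            rw [show k + 3 = (i + 2) + (j + 2) by omega, pow_add]; ring
        _ ≤ _ := by rw [← this]; gcongr
    have ef : ((k + 2).factorial : ℚ) = (k + 2) * (k + 1).factorial := by
      rw [Nat.factorial_succ]; push_cast; ring
    rw [ef, hr]
    set F : ℚ := ((k + 1).factorial : ℚ) with hF
    have hFpos : 0 < F := by positivity
    set P : ℚ := 50 ^ (k + 2) with hP
    have hPpos : 0 < P := by positivity
    have e50 : (50 : ℚ) ^ (k + 3) = 50 * P := by rw [hP]; ring
    rw [e50] at hs1 ⊢
    push_cast at *
    have hk0 : (0 : ℚ) ≤ k := by positivity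
    constructor
    · have : 50 * ((k : ℚ) + 3 - 1) ^ 2 * (1 / 50 * (P * F ^ 2)) ≤ 50 * ((k : ℚ) + 3 - 1) ^ 2 * c (k + 2) := by
        gcongr
      nlinarith
    · have h1 : 50 * ((k : ℚ) + 3 - 1) ^ 2 * c (k + 2) ≤
          50 * ((k : ℚ) + 3 - 1) ^ 2 * (1 / 10 * (1 - 1 / (k + 2 + 1)) * (P * F ^ 2)) := by
        gcongr
      have h2 : 50 * ((k : ℚ) + 3 - 1) ^ 2 * (1 / 10 * (1 - 1 / (k + 2 + 1)) * (P * F ^ 2))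
          + 1 / 2 * (k * (1 / 100 * (50 * P) * (F / (k + 1)) ^ 2))
          ≤ 1 / 10 * (1 - 1 / (k + 3 + 1)) * (50 * P * ((k + 2) * F) ^ 2) := by
        have : 1 / 10 * (1 - 1 / ((k : ℚ) + 3 + 1)) * (50 * P * ((k + 2) * F) ^ 2) -
          (50 * ((k : ℚ) + 3 - 1) ^ 2 * (1 / 10 * (1 - 1 / (k + 2 + 1)) * (P * F ^ 2))
          + 1 / 2 * (k * (1 / 100 * (50 * P) * (F / (k + 1)) ^ 2))) =
          P * F ^ 2 * (1 / 4) * (20 * (k + 2) ^ 2 * (k + 1) ^ 2 - k * (k + 3) * (k + 4)) /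
            ((k + 3) * (k + 4) * (k + 1) ^ 2) := by
          field_simp; ring
        have h4 : (0:ℚ) ≤ 20 * (k + 2) ^ 2 * (k + 1) ^ 2 - k * (k + 3) * (k + 4) := by
          have : 0 ≤ (k:ℚ)^2 := by positivity
          have : 0 ≤ (k:ℚ)^3 := by positivity
          have : 0 ≤ (k:ℚ)^4 := by positivity
          nlinarith
        have : 0 ≤ P * F ^ 2 * (1 / 4) * (20 * (k + 2) ^ 2 * (k + 1) ^ 2 - k * (k + 3) * (k + 4)) /
            ((k + 3) * (k + 4) * (k + 1) ^ 2) := by positivity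
        linarith
      linarith

lemma c_pos {c : ℕ → ℚ} (H : IsC c) (g : ℕ) (hg : 1 ≤ g) : 0 < c g :=
  lt_of_lt_of_le (by positivity) (c_bounds H g hg).1

lemma c_ratio {c : ℕ → ℚ} (H : IsC c) (g : ℕ) (hg : 3 ≤ g) : 50 * ((g : ℚ) - 1) ^ 2 * c (g - 1) ≤ c g := by
  rw [H.hrec g hg]
  have : 0 ≤ ∑ h ∈ Finset.Icc 2 (g - 2), c h * c (g - h) := by
    refine Finset.sum_nonneg fun h hh => ?_
    rw [Finset.mem_Icc] at hh
    exact (mul_pos (c_pos H _ (by omega)) (c_pos H _ (by omega))).le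
  linarith

/-- the convolution sum is small -/
lemma conv_small {c : ℕ → ℚ} (H : IsC c) (g : ℕ) (hg : 3 ≤ g) :
    ∑ i ∈ Finset.range (g - 1), c (i + 1) * c (g - (i + 1)) ≤ c g * (4 / (g : ℚ) ^ 2) := by
  rw [sum_split H g hg]
  obtain ⟨k, rfl⟩ : ∃ k, g = k + 3 := ⟨g - 3, by omega⟩
  have hr := H.hrec (k + 3) (by omega)
  have hk0 : (0 : ℚ) ≤ k := by positivity
  have e1 : k + 3 - 1 = k + 2 := by omega
  have hs : ∑ h ∈ Finset.Icc 2 (k + 3 - 2), c h * c (k + 3 - h) ≤ 25 * c (k + 2) := by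
    have l1 := (c_bounds H (k + 2) (by omega)).1
    have up : ∀ h, 1 ≤ h → c h ≤ (1 / 10) * (50 ^ h * ((h - 1).factorial : ℚ) ^ 2) := by
      intro h h1
      refine le_trans (c_bounds H h h1).2 ?_
      have : (1 / 10 : ℚ) * (1 - 1 / (h + 1)) ≤ 1 / 10 := by
        have : (0 : ℚ) ≤ 1 / (h + 1) := by positivity
        linarith
      gcongr
    have hs1 : ∑ h ∈ Finset.Icc 2 (k + 3 - 2), c h * c (k + 3 - h) ≤
        k * ((1 / 100) * 50 ^ (k + 3) * (((k + 1).factorial : ℚ) / (k + 1)) ^ 2) := by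
      have : (k : ℚ) = ((Finset.Icc 2 (k + 3 - 2)).card : ℚ) := by simp
      rw [this, ← nsmul_eq_mul]
      refine Finset.sum_le_card_nsmul _ _ _ fun h hh => ?_
      rw [Finset.mem_Icc] at hh
      have u2 := up h (by omega)
      have u3 := up (k + 3 - h) (by omega)
      obtain ⟨i, rfl⟩ : ∃ i, h = i + 2 := ⟨h - 2, by omega⟩
      obtain ⟨j, hj⟩ : ∃ j, k + 3 - (i + 2) = j + 2 := ⟨k + 3 - (i + 2) - 2, by omega⟩
      have hk : k + 1 = i + 1 + (j + 1) := by omega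
      have hf := fact_mul_le i (j + 1) (by omega)
      rw [hj] at u3 ⊢
      rw [show i + 2 - 1 = i + 1 by omega] at u2
      rw [show j + 2 - 1 = j + 1 by omega] at u3
      have hf' : ((i + 1).factorial : ℚ) * (j + 1).factorial ≤ ((k + 1).factorial : ℚ) / (k + 1) := by
        rw [le_div_iff₀ (by positivity)]
        rw [← hk] at hf
        have : (((k + 1) * ((i + 1).factorial * (j + 1).factorial) : ℕ) : ℚ) ≤ ((k + 1).factorial : ℕ) := by
          exact_mod_cast hf
        push_cast at this
        linarith
      calc c (i + 2) * c (j + 2) ≤ ((1 / 10) * (50 ^ (i + 2) * ((i + 1).factorial : ℚ) ^ 2)) *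
            ((1 / 10) * (50 ^ (j + 2) * ((j + 1).factorial : ℚ) ^ 2)) := by
            apply mul_le_mul u2 u3 (c_pos H _ (by omega)).le (by positivity)
        _ = (1 / 100) * 50 ^ (k + 3) * (((i + 1).factorial : ℚ) * (j + 1).factorial) ^ 2 := by
            rw [show k + 3 = (i + 2) + (j + 2) by omega, pow_add]; ring
        _ ≤ _ := by rw [← this]; gcongr
    refine hs1.trans ?_
    rw [show k + 2 - 1 = k + 1 by omega] at l1
    set F : ℚ := ((k + 1).factorial : ℚ) with hF
    have e50 : (50 : ℚ) ^ (k + 3) = 50 * 50 ^ (k + 2) := by ring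
    rw [e50]
    set P : ℚ := 50 ^ (k + 2) with hP
    have hPpos : 0 < P := by positivity
    have : k * ((1 / 100) * (50 * P) * (F / (k + 1)) ^ 2) = (P * F ^ 2) * (1 / 2) * (k / (k + 1) ^ 2) := by
      field_simp; ring
    rw [this]
    have : (k : ℚ) / (k + 1) ^ 2 ≤ 1 := by
      rw [div_le_one (by positivity)]; nlinarith
    have : (P * F ^ 2) * (1 / 2) * (k / (k + 1) ^ 2) ≤ (P * F ^ 2) * (1 / 2) * 1 := by gcongr
    linarith
  have hc := c_ratio H (k + 3) (by omega)
  have hp := c_pos H (k + 2) (by omega)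
  rw [e1] at hc ⊢
  have h29 : 4 * c (k + 2) + 25 * c (k + 2) ≤ c (k + 3) * (4 / ((k + 3 : ℕ) : ℚ) ^ 2) := by
    rw [mul_div_assoc', le_div_iff₀ (by positivity)]
    push_cast at hc ⊢
    have : 4 * (50 * ((k : ℚ) + 3 - 1) ^ 2 * c (k + 2)) ≤ c (k + 3) * 4 := by linarith
    refine le_trans ?_ this
    have : 29 * ((k : ℚ) + 3) ^ 2 ≤ 200 * ((k : ℚ) + 3 - 1) ^ 2 := by nlinarith
    nlinarith
  linarith

end

section


/-- the weights -/
def W (g n : ℕ) : ℚ := ∏ j ∈ Finset.range n, (5 * (3 * (g : ℚ) - 1 - j) / (2 * (5 * (g : ℚ) - 2 - j)))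

lemma W_zero (g : ℕ) : W g 0 = 1 := by simp [W]

lemma W_succ (g n : ℕ) : W g (n + 1) =
    W g n * (5 * (3 * (g : ℚ) - 1 - n) / (2 * (5 * (g : ℚ) - 2 - n))) := by
  rw [W, Finset.prod_range_succ, ← W]

lemma W_pos (g n : ℕ) (hg : 1 ≤ g) (hn : n ≤ 3 * g - 1) : 0 < W g n := by
  apply Finset.prod_pos
  intro j hj
  rw [Finset.mem_range] at hj
  have h1 : (j : ℚ) + 2 ≤ 3 * g := by exact_mod_cast (by omega : j + 2 ≤ 3 * g)
  have h2 : (1 : ℚ) ≤ g := by exact_mod_cast hg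
  apply div_pos <;> linarith

lemma W_eq_zero (g n : ℕ) (hg : 1 ≤ g) (hn : 3 * g ≤ n) : W g n = 0 := by
  apply Finset.prod_eq_zero (i := 3 * g - 1)
  · rw [Finset.mem_range]; omega
  · have : ((3 * g - 1 : ℕ) : ℚ) = 3 * g - 1 := by
      rw [Nat.cast_sub (by omega)]; push_cast; ring
    rw [this]; simp

lemma W_nonneg (g n : ℕ) (hg : 1 ≤ g) : 0 ≤ W g n := by
  by_cases h : n ≤ 3 * g - 1
  · exact (W_pos g n hg h).le
  · rw [W_eq_zero g n hg (by omega)]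

lemma W_mono_aux (i k n : ℕ) (hi : 1 ≤ i) (hk : i ≤ k) (hn : n + 1 ≤ 3 * i - 1) :
    W i (n + 1) ≤ 10 / 9 * W k (n + 1) := by
  have h2 : (1 : ℚ) ≤ i := by exact_mod_cast hi
  have h3 : (i : ℚ) ≤ k := by exact_mod_cast hk
  induction n with
  | zero =>
    rw [W_succ, W_succ, W_zero, W_zero]
    simp only [Nat.cast_zero, sub_zero, one_mul]
    rw [← mul_div_assoc, div_le_div_iff₀ (by linarith) (by linarith)]
    nlinarith
  | succ n ih =>
    have ih := ih (by omega)
    rw [W_succ i, W_succ k, ← mul_assoc]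
    have h1 : ((n : ℚ) + 1) + 2 ≤ 3 * i := by exact_mod_cast (by omega : n + 1 + 2 ≤ 3 * i)
    have hn0 : (0 : ℚ) ≤ n := by positivity
    push_cast
    apply mul_le_mul ih _ _ _
    · rw [div_le_div_iff₀ (by linarith) (by linarith)]
      nlinarith [mul_nonneg (sub_nonneg.2 h3) (by linarith : (0:ℚ) ≤ 2 * n + 1)]
    · apply div_nonneg <;> linarith
    · have := W_nonneg k (n + 1) (by omega); linarith

lemma W_mono (i k n : ℕ) (hi : 1 ≤ i) (hk : i ≤ k) : W i n ≤ 10 / 9 * W k n := by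
  rcases n with _ | n
  · rw [W_zero, W_zero]; norm_num
  · by_cases h : n + 1 ≤ 3 * i - 1
    · exact W_mono_aux i k n hi hk h
    · rw [W_eq_zero i _ hi (by omega)]
      have := W_nonneg k (n + 1) (by omega); linarith

/-- falling factorial of length three -/
def pf (x : ℚ) : ℚ := x * (x - 1) * (x - 2)
/-- falling factorial of length five -/
def qf (y : ℚ) : ℚ := y * (y - 1) * (y - 2) * (y - 3) * (y - 4)

lemma W_exact (g n : ℕ) (hg : 3 ≤ g) (hn : n ≤ 3 * g - 1) :
    W (g - 1) n * pf (3 * g - 1) * qf (5 * g - 2 - n) =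
      W g n * pf (3 * g - 1 - n) * qf (5 * g - 2) := by
  induction n with
  | zero => simp [W_zero]
  | succ n ih =>
    have ih := ih (by omega)
    have h1 : (n : ℚ) + 2 ≤ 3 * g := by exact_mod_cast (by omega : n + 2 ≤ 3 * g)
    have h2 : (3 : ℚ) ≤ g := by exact_mod_cast hg
    have ec : ((g - 1 : ℕ) : ℚ) = g - 1 := by rw [Nat.cast_sub (by omega)]; simp
    rw [W_succ, W_succ, ec]
    have p1 : (5 * (g : ℚ) - 7 - n) ≠ 0 := by apply ne_of_gt; linarith
    have p2 : (5 * (g : ℚ) - 2 - n) ≠ 0 := by apply ne_of_gt; linarith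
    have e1 : (5 * ((g : ℚ) - 1) - 2 - n) = 5 * (g : ℚ) - 7 - n := by ring
    rw [e1]
    have eq : qf (5 * g - 2 - ((n + 1 : ℕ) : ℚ)) * (5 * (g : ℚ) - 2 - n) =
        qf (5 * g - 2 - n) * (5 * (g : ℚ) - 7 - n) := by
      unfold qf; push_cast; ring
    have ep : pf (3 * g - 1 - ((n + 1 : ℕ) : ℚ)) * (3 * (g : ℚ) - 1 - n) =
        pf (3 * g - 1 - n) * (3 * (g : ℚ) - 4 - n) := by
      unfold pf; push_cast; ring
    have eq' : qf (5 * g - 2 - ((n + 1 : ℕ) : ℚ)) =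
        qf (5 * g - 2 - n) * (5 * (g : ℚ) - 7 - n) / (5 * (g : ℚ) - 2 - n) := by
      rw [eq_div_iff p2, eq]
    rw [eq']
    calc W (g - 1) n * (5 * (3 * ((g : ℚ) - 1) - 1 - n) / (2 * (5 * (g : ℚ) - 7 - n))) * pf (3 * g - 1) *
          (qf (5 * g - 2 - n) * (5 * (g : ℚ) - 7 - n) / (5 * (g : ℚ) - 2 - n))
        = (W (g - 1) n * pf (3 * g - 1) * qf (5 * g - 2 - n)) *
          (5 * (3 * (g : ℚ) - 4 - n)) / (2 * (5 * (g : ℚ) - 2 - n)) := by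
          field_simp; ring
      _ = W g n * (5 / (2 * (5 * (g : ℚ) - 2 - n))) *
            (pf (3 * g - 1 - n) * (3 * (g : ℚ) - 4 - n)) * qf (5 * g - 2) := by
          rw [ih]; field_simp
      _ = _ := by rw [← ep]; field_simp

lemma W_prev (g n : ℕ) (hg : 5 ≤ g) (hn : n ≤ 3 * g - 1) :
    W (g - 1) n * (g : ℚ) ^ 2 ≤ 1200 * (3 * (g : ℚ) - 1 - n) ^ 2 * W g n := by
  have h := W_exact g n (by omega) hn
  have hg' : (5 : ℚ) ≤ g := by exact_mod_cast hg
  have hw := W_nonneg (g - 1) n (by omega)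
  have hw' := W_nonneg g n (by omega)
  obtain ⟨x, hx⟩ : ∃ x : ℕ, x + n + 1 = 3 * g := ⟨3 * g - 1 - n, by omega⟩
  have hx' : 3 * (g : ℚ) - 1 - n = x := by
    have : ((x : ℚ) + n + 1) = 3 * g := by exact_mod_cast hx
    linarith
  have hy : 5 * (g : ℚ) - 2 - n = x + 2 * g - 1 := by linarith
  rw [hx', hy] at h
  rw [hx']
  rcases Nat.eq_zero_or_pos x with h0 | hpos
  · subst h0
    have hq : 0 < pf (3 * g - 1) * qf (((0 : ℕ) : ℚ) + 2 * g - 1) := by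
      unfold pf qf
      push_cast
      have a1 : (0:ℚ) < 3 * g - 1 := by linarith
      have a2 : (0:ℚ) < 3 * g - 1 - 1 := by linarith
      have a3 : (0:ℚ) < 3 * g - 1 - 2 := by linarith
      have b1 : (0:ℚ) < 0 + 2 * g - 1 := by linarith
      have b2 : (0:ℚ) < 0 + 2 * g - 1 - 1 := by linarith
      have b3 : (0:ℚ) < 0 + 2 * g - 1 - 2 := by linarith
      have b4 : (0:ℚ) < 0 + 2 * g - 1 - 3 := by linarith
      have b5 : (0:ℚ) < 0 + 2 * g - 1 - 4 := by linarith
      positivity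
    have : W (g - 1) n = 0 := by
      have h' : W (g - 1) n * (pf (3 * g - 1) * qf (((0 : ℕ) : ℚ) + 2 * g - 1)) = 0 := by
        rw [← mul_assoc, h]; simp [pf]
      rcases mul_eq_zero.1 h' with h' | h'
      · exact h'
      · exact absurd h' hq.ne'
    rw [this]; simp
  have hx1 : (1 : ℚ) ≤ x := by exact_mod_cast hpos
  have hp : pf x ≤ x ^ 2 * x := by
    unfold pf
    have : (x : ℚ) * ((x : ℚ) - 1) * (x - 2) = x * ((x - 1) * (x - 2)) := by ring
    rw [this, show (x : ℚ) ^ 2 * x = x * x ^ 2 by ring]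
    apply mul_le_mul_of_nonneg_left _ (by linarith)
    nlinarith
  have hq : qf (5 * g - 2) ≤ 3125 * (g : ℚ) ^ 5 := by
    unfold qf
    calc (5 * (g : ℚ) - 2) * (5 * g - 2 - 1) * (5 * g - 2 - 2) * (5 * g - 2 - 3) * (5 * g - 2 - 4)
        ≤ (5 * g) * (5 * g) * (5 * g) * (5 * g) * (5 * g) := by
          have : (0 : ℚ) ≤ 5 * g - 2 - 1 := by linarith
          have : (0 : ℚ) ≤ 5 * g - 2 - 2 := by linarith
          have : (0 : ℚ) ≤ 5 * g - 2 - 3 := by linarith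
          have : (0 : ℚ) ≤ 5 * g - 2 - 4 := by linarith
          gcongr <;> linarith
      _ = _ := by ring
  have hp3 : 8 * (g : ℚ) ^ 3 ≤ pf (3 * g - 1) := by
    unfold pf
    calc 8 * (g : ℚ) ^ 3 = (2 * g) * (2 * g) * (2 * g) := by ring
      _ ≤ _ := by
        have : (0 : ℚ) ≤ 3 * g - 1 := by linarith
        have : (0 : ℚ) ≤ 3 * g - 1 - 1 := by linarith
        gcongr <;> linarith
  have hq5 : (x : ℚ) * g ^ 4 ≤ qf (x + 2 * g - 1) := by
    unfold qf
    calc (x : ℚ) * g ^ 4 = x * g * g * g * g := by ring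
      _ ≤ _ := by
        have : (0 : ℚ) ≤ x + 2 * g - 1 := by linarith
        have : (0 : ℚ) ≤ x + 2 * g - 1 - 1 := by linarith
        have : (0 : ℚ) ≤ x + 2 * g - 1 - 2 := by linarith
        have : (0 : ℚ) ≤ x + 2 * g - 1 - 3 := by linarith
        gcongr <;> linarith
  have hP : 0 < 8 * (g : ℚ) ^ 3 * (x * g ^ 4) := by positivity
  have k1 : W (g - 1) n * (8 * (g : ℚ) ^ 3 * (x * g ^ 4)) ≤ W g n * (x ^ 2 * x) * (3125 * (g : ℚ) ^ 5) := by
    calc W (g - 1) n * (8 * (g : ℚ) ^ 3 * (x * g ^ 4))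
        ≤ W (g - 1) n * (pf (3 * g - 1) * qf (x + 2 * g - 1)) := by
          have : 0 ≤ pf (3 * g - 1) := le_trans (by positivity) hp3
          gcongr
      _ = W g n * pf x * qf (5 * g - 2) := by rw [← mul_assoc, h]
      _ ≤ W g n * (x ^ 2 * x) * qf (5 * g - 2) := by
          have : 0 ≤ qf (5 * g - 2) := by
            unfold qf
            have : (0 : ℚ) ≤ 5 * g - 2 := by linarith
            have : (0 : ℚ) ≤ 5 * g - 2 - 1 := by linarith
            have : (0 : ℚ) ≤ 5 * g - 2 - 2 := by linarith
            have : (0 : ℚ) ≤ 5 * g - 2 - 3 := by linarith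
            have : (0 : ℚ) ≤ 5 * g - 2 - 4 := by linarith
            positivity
          gcongr
      _ ≤ _ := by gcongr
  have hxg : 0 < (x : ℚ) * g ^ 5 := by positivity
  have k2 : (x * (g : ℚ) ^ 5) * (8 * (W (g - 1) n * (g : ℚ) ^ 2)) ≤
      (x * (g : ℚ) ^ 5) * (3125 * (x ^ 2 * W g n)) := by
    calc _ = W (g - 1) n * (8 * (g : ℚ) ^ 3 * (x * g ^ 4)) := by ring
      _ ≤ _ := k1
      _ = _ := by ring
  have k3 := le_of_mul_le_mul_left k2 hxg
  have : 0 ≤ (x : ℚ) ^ 2 * W g n := by positivity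
  nlinarith

lemma W_le (g i n : ℕ) (hg : 5 ≤ g) (hn : n ≤ 3 * g - 1) (hi : 1 ≤ i) (hig : i < g) :
    W i n * (g : ℚ) ^ 2 ≤ 1400 * (3 * (g : ℚ) - 1 - n) ^ 2 * W g n := by
  have h1 := W_mono i (g - 1) n hi (by omega)
  have h2 := W_prev g n hg hn
  have hw' := W_nonneg g n (by omega)
  have h3 : W i n * (g : ℚ) ^ 2 ≤ 10 / 9 * W (g - 1) n * (g : ℚ) ^ 2 := by gcongr
  have : 0 ≤ (3 * (g : ℚ) - 1 - n) ^ 2 * W g n := by positivity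
  nlinarith

end

section


lemma term_bound {c : ℕ → ℚ} (H : IsC c) (K : ℚ) (hK : 1 ≤ K) (g i n : ℕ) (hg : 5 ≤ g)
    (hn : n + 1 ≤ 3 * g - 1) (hi : 1 ≤ i) (hig : i < g)
    (hyp : ∀ m, |aa c i (m + 1)| ≤ K * c i * W i m) :
    |(10 * (i : ℚ) - 5 * g - n) * aa c i (n + 1) + (n + 1 / 2) * aa c i n| ≤
      60000 * K * c i * ((3 * (g : ℚ) - 1 - n) * W g n) := by
  obtain ⟨x, hx⟩ : ∃ x : ℕ, x + n + 1 = 3 * g := ⟨3 * g - 1 - n, by omega⟩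
  have hxq : ((x : ℚ) + n + 1) = 3 * g := by exact_mod_cast hx
  have hx' : 3 * (g : ℚ) - 1 - n = x := by linarith
  have hx1 : (1 : ℚ) ≤ x := by exact_mod_cast (by omega : 1 ≤ x)
  have hg' : (5 : ℚ) ≤ g := by exact_mod_cast hg
  have hi' : (1 : ℚ) ≤ i := by exact_mod_cast hi
  have hig' : (i : ℚ) + 1 ≤ g := by exact_mod_cast hig
  have hn0 : (0 : ℚ) ≤ n := by positivity
  have hci := c_pos H i hi
  have hw := W_nonneg g n (by omega)
  have hwi := W_nonneg i n hi
  have hKc : 0 < K * c i := by positivity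
  have hgp : (0 : ℚ) < g := by linarith
  rw [hx']
  have b1 : |(10 * (i : ℚ) - 5 * g - n) * aa c i (n + 1)| ≤ 33600 * (K * c i) * (x * W g n) := by
    rw [abs_mul]
    have c1 : |10 * (i : ℚ) - 5 * g - n| ≤ 8 * g := by
      rw [abs_le]; constructor <;> linarith
    have w1 := W_le g i n hg (by omega) hi hig
    rw [hx'] at w1
    have w2 : W i n * g ≤ 4200 * (x * W g n) := by
      have : (W i n * g) * g ≤ (4200 * (x * W g n)) * g := by
        have : (1400 * (x : ℚ) * W g n) * x ≤ (1400 * (x : ℚ) * W g n) * (3 * g) := by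
          gcongr; linarith
        nlinarith
      exact le_of_mul_le_mul_right this hgp
    calc _ ≤ (8 * (g : ℚ)) * (K * c i * W i n) := by gcongr; exact hyp n
      _ = 8 * (K * c i) * (W i n * g) := by ring
      _ ≤ 8 * (K * c i) * (4200 * (x * W g n)) := by gcongr
      _ = _ := by ring
  have b2 : |((n : ℚ) + 1 / 2) * aa c i n| ≤ 16800 * (K * c i) * (x * W g n) := by
    rcases n with _ | n
    · obtain ⟨i', rfl⟩ : ∃ i', i = i' + 1 := ⟨i - 1, by omega⟩
      rw [aa_succ_zero]; simp only [mul_zero, abs_zero]; positivity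
    · rw [abs_mul]
      have hw0 := W_nonneg g n (by omega)
      have c1 : |((n + 1 : ℕ) : ℚ) + 1 / 2| ≤ 3 * g := by
        rw [abs_of_nonneg (by positivity)]; push_cast at hxq ⊢; linarith
      have w1 := W_le g i n hg (by omega) hi hig
      have e0 : 3 * (g : ℚ) - 1 - n = x + 1 := by push_cast at hxq; linarith
      rw [e0] at w1
      have w3 : W g n * (x + 1) ≤ 2 * g * W g (n + 1) := by
        rw [W_succ, e0]
        push_cast at hxq
        have hd : 0 < 2 * (5 * (g : ℚ) - 2 - n) := by linarith
        have : W g n * (x + 1) = W g n * (5 * ((x : ℚ) + 1) / (2 * (5 * (g : ℚ) - 2 - n))) *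
            ((2 * (5 * (g : ℚ) - 2 - n)) / 5) := by
          have hd2 : (5 * (g : ℚ) - 2 - n) ≠ 0 := by apply ne_of_gt; linarith
          field_simp
        rw [this, mul_comm (2 * (g : ℚ))]
        gcongr
        linarith
      have w2 : W i n * g ≤ 2800 * ((x + 1) * W g (n + 1)) := by
        have : (W i n * g) * g ≤ (2800 * ((x + 1) * W g (n + 1))) * g := by
          calc (W i n * g) * g = W i n * (g : ℚ) ^ 2 := by ring
            _ ≤ _ := w1
            _ = 1400 * (x + 1) * (W g n * (x + 1)) := by ring
            _ ≤ 1400 * (x + 1) * (2 * g * W g (n + 1)) := by gcongr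
            _ = _ := by ring
        exact le_of_mul_le_mul_right this hgp
      calc _ ≤ (3 * (g : ℚ)) * (K * c i * W i n) := by gcongr; exact hyp n
        _ = 3 * (K * c i) * (W i n * g) := by ring
        _ ≤ 3 * (K * c i) * (2800 * ((x + x) * W g (n + 1))) := by
            refine mul_le_mul_of_nonneg_left (w2.trans ?_) (by positivity)
            gcongr
        _ = _ := by ring
  have b3 := abs_add_le ((10 * (i : ℚ) - 5 * g - n) * aa c i (n + 1)) ((n + 1 / 2) * aa c i n)
  have : 0 ≤ (K * c i) * (x * W g n) := by positivity
  nlinarith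

lemma aa_one {c : ℕ → ℚ} (g : ℕ) : aa c (g + 1) 1 = c (g + 1) / 2 := by
  have h := aa_rec c g 0
  rw [Finset.sum_range_succ', Finset.sum_eq_zero] at h
  · simp [aa_zero, aa_succ_zero] at h
    have hp : (0 : ℚ) < 5 * ((g : ℚ) + 1) - 1 := by
      have : (0 : ℚ) ≤ g := by positivity
      linarith
    have : (5 * ((g : ℚ) + 1) - 1) * aa c (g + 1) 1 = (5 * ((g : ℚ) + 1) - 1) * (c (g + 1) / 2) := by
      linarith
    exact mul_left_cancel₀ hp.ne' this
  · intro i _; simp [aa_succ_zero]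

/-- the error term in the recursion -/
def EE (c : ℕ → ℚ) (g n : ℕ) : ℚ := ∑ i ∈ Finset.range g, c (g - i) *
  ((10 * (i : ℚ) - 5 * g - n) * aa c i (n + 1) + (n + 1 / 2) * aa c i n)

lemma rec_EE (c : ℕ → ℚ) (g n : ℕ) (hg : 1 ≤ g) :
    2 * (5 * (g : ℚ) - 2 - n) * aa c g (n + 2) =
      5 * (3 * (g : ℚ) - 1 - n) * aa c g (n + 1) - EE c g n := by
  obtain ⟨k, rfl⟩ : ∃ k, g = k + 1 := ⟨g - 1, by omega⟩
  have h := aa_rec c k (n + 1)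
  have : EE c (k + 1) n = ∑ i ∈ Finset.range (k + 1), c (k + 1 - i) *
        ((10 * (i : ℚ) - 5 * ((k : ℚ) + 1) - (n + 1 : ℕ) + 1) * aa c i (n + 1) +
          (((n + 1 : ℕ) : ℚ) - 1 / 2) * (if n + 1 = 0 then 0 else aa c i (n + 1 - 1))) := by
    unfold EE
    refine Finset.sum_congr rfl fun i _ => ?_
    simp only [Nat.add_sub_cancel, Nat.succ_ne_zero, if_false]
    push_cast; ring
  rw [this]
  have e : n + 1 + 1 = n + 2 := rfl
  rw [e] at h
  push_cast at h ⊢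
  linarith

lemma EE_bound {c : ℕ → ℚ} (H : IsC c) (K : ℚ) (hK : 1 ≤ K) (g n : ℕ) (hg : 5 ≤ g)
    (hn : n + 1 ≤ 3 * g - 1)
    (hyp : ∀ i, 1 ≤ i → i < g → ∀ m, |aa c i (m + 1)| ≤ K * c i * W i m) :
    |EE c g n| ≤ 5 * ((3 * (g : ℚ) - 1 - n) * W g n) * (48000 * K * c g / g ^ 2) +
      (if n = 0 then c g / 2 else 0) := by
  unfold EE
  obtain ⟨k, rfl⟩ : ∃ k, g = k + 1 := ⟨g - 1, by omega⟩
  rw [Finset.sum_range_succ']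
  refine (abs_add_le _ _).trans ?_
  have hn2 : (n : ℚ) + 2 ≤ 3 * (k + 1 : ℕ) := by exact_mod_cast (by omega : n + 2 ≤ 3 * (k + 1))
  apply add_le_add
  · refine (Finset.abs_sum_le_sum_abs _ _).trans ?_
    have hs := conv_small H (k + 1) (by omega)
    rw [Nat.add_sub_cancel] at hs
    have hw := W_nonneg (k + 1) n (by omega)
    have hxw : 0 ≤ (3 * ((k + 1 : ℕ) : ℚ) - 1 - n) * W (k + 1) n :=
      mul_nonneg (by linarith) hw
    calc _ ≤ ∑ i ∈ Finset.range k, (60000 * K * ((3 * ((k + 1 : ℕ) : ℚ) - 1 - n) * W (k + 1) n)) *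
            (c (i + 1) * c (k + 1 - (i + 1))) := by
          refine Finset.sum_le_sum fun i hi => ?_
          rw [Finset.mem_range] at hi
          rw [abs_mul]
          have hc := c_pos H (k + 1 - (i + 1)) (by omega)
          rw [abs_of_pos hc]
          have := term_bound H K hK (k + 1) (i + 1) n hg hn (by omega) (by omega)
            (hyp (i + 1) (by omega) (by omega))
          calc _ ≤ c (k + 1 - (i + 1)) * _ := mul_le_mul_of_nonneg_left this hc.le
            _ = _ := by ring
      _ = (60000 * K * ((3 * ((k + 1 : ℕ) : ℚ) - 1 - n) * W (k + 1) n)) *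
            ∑ i ∈ Finset.range k, c (i + 1) * c (k + 1 - (i + 1)) := by rw [Finset.mul_sum]
      _ ≤ (60000 * K * ((3 * ((k + 1 : ℕ) : ℚ) - 1 - n) * W (k + 1) n)) *
            (c (k + 1) * (4 / ((k + 1 : ℕ) : ℚ) ^ 2)) := by gcongr
      _ = _ := by ring
  · have hc := c_pos H (k + 1) (by omega)
    rcases n with _ | n
    · simp [aa_zero]
      rw [abs_of_pos hc]; linarith
    · simp [aa_zero]

lemma main_step {c : ℕ → ℚ} (H : IsC c) (K : ℚ) (hK : 1 ≤ K) (g : ℕ) (hg : 5 ≤ g)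
    (hyp : ∀ i, 1 ≤ i → i < g → ∀ m, |aa c i (m + 1)| ≤ K * c i * W i m)
    (n : ℕ) (hn : n ≤ 3 * g - 1) :
    |aa c g (n + 1) - c g / 2 * W g n| ≤
      (n * (48000 * K * c g / g ^ 2) + c g / (20 * g)) * W g n := by
  have hc := c_pos H g (by omega)
  have hgq : (5 : ℚ) ≤ g := by exact_mod_cast hg
  have h0 : |aa c g 1 - c g / 2 * W g 0| = 0 := by
    obtain ⟨k, rfl⟩ : ∃ k, g = k + 1 := ⟨g - 1, by omega⟩
    rw [aa_one, W_zero]; simp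
  have hD : 0 ≤ 48000 * K * c g / g ^ 2 := by positivity
  have he : 0 ≤ c g / (20 * g) := by positivity
  set D := 48000 * K * c g / g ^ 2
  set e := c g / (20 * g) with hee
  induction n with
  | zero =>
    rw [h0, W_zero]; simp; positivity
  | succ n ih =>
    have ih := ih (by omega)
    have hn2 : (n : ℚ) + 2 ≤ 3 * g := by exact_mod_cast (by omega : n + 2 ≤ 3 * g)
    have hE := EE_bound H K hK g n hg hn hyp
    have hr := rec_EE c g n (by omega)
    have hw := W_pos g n (by omega) (by omega)
    set x : ℚ := 3 * (g : ℚ) - 1 - n with hx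
    have hx1 : 1 ≤ x := by linarith
    set y : ℚ := 2 * (5 * (g : ℚ) - 2 - n) with hy
    have hyp : 0 < y := by linarith
    have hW : W g (n + 1) = W g n * (5 * x / y) := W_succ g n
    have key : 5 * x * |aa c g (n + 1) - c g / 2 * W g n| + |EE c g n| ≤
        5 * x * (((n + 1) * D + e) * W g n) := by
      rcases Nat.eq_zero_or_pos n with h | h
      · subst h
        rw [if_pos rfl] at hE
        simp only [zero_add] at *
        rw [h0]
        have hx0 : x = 3 * (g : ℚ) - 1 := by rw [hx]; simp
        have : c g / 2 ≤ 5 * x * e := by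
          rw [hee, hx0]
          rw [mul_div_assoc', div_le_div_iff₀ (by norm_num) (by linarith)]
          nlinarith
        rw [W_zero] at hE ⊢
        simp only [Nat.cast_zero]
        linarith
      · rw [if_neg (by omega)] at hE
        have : 5 * x * |aa c g (n + 1) - c g / 2 * W g n| ≤ 5 * x * ((n * D + e) * W g n) := by
          gcongr
        have e1 : 5 * x * (((n + 1) * D + e) * W g n) =
          5 * x * ((n * D + e) * W g n) + 5 * (x * W g n) * D := by ring
        linarith
    have e2 : aa c g (n + 1 + 1) - c g / 2 * W g (n + 1) =
        (5 * x * (aa c g (n + 1) - c g / 2 * W g n) - EE c g n) / y := by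
      rw [eq_div_iff hyp.ne', hW]
      have : (aa c g (n + 1 + 1) - c g / 2 * (W g n * (5 * x / y))) * y =
        y * aa c g (n + 2) - c g / 2 * (W g n * (5 * x)) := by
        field_simp
      rw [this, hr]; ring
    rw [e2, abs_div, abs_of_pos hyp, div_le_iff₀ hyp, hW]
    push_cast
    calc _ ≤ |5 * x * (aa c g (n + 1) - c g / 2 * W g n)| + |EE c g n| := abs_sub _ _
      _ = 5 * x * |aa c g (n + 1) - c g / 2 * W g n| + |EE c g n| := by
          rw [abs_mul, abs_of_pos (by linarith : 0 < 5 * x)]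
      _ ≤ _ := key
      _ = _ := by field_simp

lemma main_step' {c : ℕ → ℚ} (H : IsC c) (K : ℚ) (hK : 1 ≤ K) (g : ℕ) (hg : 5 ≤ g)
    (hyp : ∀ i, 1 ≤ i → i < g → ∀ m, |aa c i (m + 1)| ≤ K * c i * W i m)
    (n : ℕ) (hn : n ≤ 3 * g - 1) :
    |aa c g (n + 1) - c g / 2 * W g n| ≤ 150000 * K / g * (c g * W g n) := by
  refine (main_step H K hK g hg hyp n hn).trans ?_
  have hc := c_pos H g (by omega)
  have hw := W_pos g n (by omega) hn
  have hgq : (5 : ℚ) ≤ g := by exact_mod_cast hg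
  have hnq : (n : ℚ) ≤ 3 * g := by exact_mod_cast (by omega : n ≤ 3 * g)
  have h1 : (n : ℚ) * (48000 * K * c g / g ^ 2) ≤ (3 * g) * (48000 * K * c g / g ^ 2) := by gcongr
  have h2 : (3 * (g : ℚ)) * (48000 * K * c g / g ^ 2) = 144000 * K * c g / g := by
    field_simp; ring
  have h3 : c g / (20 * g) ≤ 6000 * K * c g / g := by
    rw [div_le_div_iff₀ (by positivity) (by positivity)]
    have : 0 < c g * g := by positivity
    nlinarith
  have h4 : 150000 * K / g * (c g * W g n) = (144000 * K * c g / g + 6000 * K * c g / g) * W g n := by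
    ring
  rw [h4]
  gcongr
  linarith

lemma exists_K {c : ℕ → ℚ} (H : IsC c) :
    ∃ K : ℚ, 1 ≤ K ∧ ∀ g, 1 ≤ g → ∀ n, |aa c g (n + 1)| ≤ K * c g * W g n := by
  obtain ⟨N, hN⟩ : ∃ N : ℕ, N = 300000 := ⟨_, rfl⟩
  have hS : 0 ≤ ∑ g ∈ Finset.range N, ∑ n ∈ Finset.range (3 * g),
    |aa c g (n + 1) / (c g * W g n)| :=
    Finset.sum_nonneg fun _ _ => Finset.sum_nonneg fun _ _ => abs_nonneg _
  refine ⟨1 + ∑ g ∈ Finset.range N, ∑ n ∈ Finset.range (3 * g),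
    |aa c g (n + 1) / (c g * W g n)|, by linarith, ?_⟩
  set S := ∑ g ∈ Finset.range N, ∑ n ∈ Finset.range (3 * g),
    |aa c g (n + 1) / (c g * W g n)| with hSd
  intro g
  induction g using Nat.strong_induction_on with
  | _ g ih =>
    intro hg n
    have hc := c_pos H g hg
    by_cases hn : n ≤ 3 * g - 1
    swap
    · rw [aa_supp c g _ (by omega), W_eq_zero g n hg (by omega)]; simp
    have hw := W_pos g n hg hn
    have hcw : 0 < c g * W g n := by positivity
    by_cases hgN : g < N
    · have h1 : |aa c g (n + 1) / (c g * W g n)| ≤ S := by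
        refine le_trans ?_ (Finset.single_le_sum (f := fun g => ∑ n ∈ Finset.range (3 * g),
          |aa c g (n + 1) / (c g * W g n)|)
          (fun _ _ => Finset.sum_nonneg fun _ _ => abs_nonneg _) (Finset.mem_range.2 hgN))
        exact Finset.single_le_sum (f := fun n => |aa c g (n + 1) / (c g * W g n)|)
          (fun _ _ => abs_nonneg _) (Finset.mem_range.2 (by omega))
      rw [abs_div, abs_of_pos hcw, div_le_iff₀ hcw] at h1
      linarith
    · have h := main_step' H (1 + S) (by linarith) g (by omega)
        (fun i h1 h2 m => ih i h2 h1 m) n hn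
      have hgq : (300000 : ℚ) ≤ g := by exact_mod_cast (by omega : 300000 ≤ g)
      have h2 : 150000 * (1 + S) / g ≤ (1 + S) / 2 := by
        rw [div_le_div_iff₀ (by linarith) (by norm_num)]
        nlinarith
      have h3 : 150000 * (1 + S) / g * (c g * W g n) ≤ (1 + S) / 2 * (c g * W g n) := by gcongr
      rw [abs_le] at h ⊢
      have h4 : 0 ≤ S * (c g * W g n) := by positivity
      constructor <;> nlinarith

lemma main_bound {c : ℕ → ℚ} (H : IsC c) :
    ∃ K : ℚ, 1 ≤ K ∧ ∀ g, 5 ≤ g →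
      |aa c g (3 * g) - c g / 2 * W g (3 * g - 1)| ≤ K / g * (c g * W g (3 * g - 1)) := by
  obtain ⟨K, hK, h⟩ := exists_K H
  refine ⟨150000 * K, by linarith, fun g hg => ?_⟩
  have := main_step' H K hK g hg (fun i h1 _ m => h i h1 m) (3 * g - 1) le_rfl
  rwa [show 3 * g - 1 + 1 = 3 * g by omega] at this

end

section


lemma W_fact (g n : ℕ) (hg : 1 ≤ g) (hn : n ≤ 3 * g - 1) :
    W g n * (5 * g - 2).factorial * (3 * g - 1 - n).factorial * 2 ^ n =
      5 ^ n * (3 * g - 1).factorial * (5 * g - 2 - n).factorial := by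
  induction n with
  | zero => simp [W_zero]; ring
  | succ n ih =>
    have ih := ih (by omega)
    obtain ⟨x, hx⟩ : ∃ x, 3 * g = x + n + 2 := ⟨3 * g - 2 - n, by omega⟩
    have e1 : 3 * g - 1 - n = x + 1 := by omega
    have e2 : 3 * g - 1 - (n + 1) = x := by omega
    obtain ⟨y, hy⟩ : ∃ y, 5 * g = y + n + 3 := ⟨5 * g - 3 - n, by omega⟩
    have e3 : 5 * g - 2 - n = y + 1 := by omega
    have e4 : 5 * g - 2 - (n + 1) = y := by omega
    have hx' : 3 * (g : ℚ) - 1 - n = x + 1 := by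
      have : (3 * g : ℚ) = x + n + 2 := by exact_mod_cast hx
      linarith
    have hy' : 5 * (g : ℚ) - 2 - n = y + 1 := by
      have : (5 * g : ℚ) = y + n + 3 := by exact_mod_cast hy
      linarith
    rw [e1, e3, Nat.factorial_succ, Nat.factorial_succ] at ih
    rw [e2, e4, W_succ, hx', hy']
    push_cast at ih
    have hyp : (0 : ℚ) < (y : ℚ) + 1 := by positivity
    have : W g n * (5 * ((x : ℚ) + 1) / (2 * (y + 1))) * (5 * g - 2).factorial * x.factorial * 2 ^ (n + 1)
      = (W g n * (5 * g - 2).factorial * ((x + 1) * x.factorial) * 2 ^ n) * 5 / (y + 1) := by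
      field_simp; ring
    rw [this, ih]; field_simp; ring

lemma W_last (g : ℕ) (hg : 1 ≤ g) :
    (W g (3 * g - 1) : ℝ) = 125 ^ g * (3 * g).factorial * (2 * g).factorial * (5 * g - 1) /
      (8 ^ g * (5 * g).factorial * (3 * g)) := by
  have h := W_fact g (3 * g - 1) hg le_rfl
  obtain ⟨k, rfl⟩ : ∃ k, g = k + 1 := ⟨g - 1, by omega⟩
  rw [show 5 * (k + 1) - 2 - (3 * (k + 1) - 1) = 2 * k + 1 by omega, Nat.sub_self,
    show 5 * (k + 1) - 2 = 5 * k + 3 by omega, show 3 * (k + 1) - 1 = 3 * k + 2 by omega] at h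
  have h' : (W (k + 1) (3 * k + 2) : ℝ) * (5 * k + 3).factorial * 2 ^ (3 * k + 2) =
    5 ^ (3 * k + 2) * (3 * k + 2).factorial * (2 * k + 1).factorial := by
    have := congrArg (fun q : ℚ => (q : ℝ)) h
    push_cast at this
    simpa using this
  rw [show 3 * (k + 1) - 1 = 3 * k + 2 by omega]
  rw [show 3 * (k + 1) = (3 * k + 2) + 1 by ring, show 2 * (k + 1) = (2 * k + 1) + 1 by ring,
    show 5 * (k + 1) = (5 * k + 3) + 1 + 1 by ring]
  rw [Nat.factorial_succ (3 * k + 2), Nat.factorial_succ (2 * k + 1), Nat.factorial_succ (5 * k + 3 + 1),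
    Nat.factorial_succ (5 * k + 3)]
  have e8 : (8 : ℝ) ^ (k + 1) = 2 * 2 ^ (3 * k + 2) := by
    rw [show (8 : ℝ) = 2 ^ 3 by norm_num, ← pow_mul]; ring
  have e125 : (125 : ℝ) ^ (k + 1) = 5 * 5 ^ (3 * k + 2) := by
    rw [show (125 : ℝ) = 5 ^ 3 by norm_num, ← pow_mul]; ring
  rw [e8, e125, eq_div_iff (by positivity)]
  push_cast
  linear_combination (2 * (5 * (k : ℝ) + 5) * (5 * k + 4) * (3 * k + 3)) * h'

lemma fact_eq (k g : ℕ) (hk : 1 ≤ k) (hg : 1 ≤ g) :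
    ((k * g).factorial : ℝ) = Stirling.stirlingSeq (k * g) * (√(2 * k) * √g) *
      (((k : ℝ) ^ k) ^ g * (((g : ℝ) / Real.exp 1) ^ g) ^ k) := by
  rw [Stirling.stirlingSeq]
  have hk' : (0 : ℝ) < k := by exact_mod_cast hk
  have hg' : (0 : ℝ) < g := by exact_mod_cast hg
  have e1 : √(2 * ((k * g : ℕ) : ℝ)) = √(2 * k) * √g := by
    rw [← Real.sqrt_mul (by positivity)]; push_cast; ring_nf
  have e2 : (((k * g : ℕ) : ℝ) / Real.exp 1) ^ (k * g) =
      ((k : ℝ) ^ k) ^ g * (((g : ℝ) / Real.exp 1) ^ g) ^ k := by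
    rw [← pow_mul, ← pow_mul, mul_comm g k, ← mul_pow]; push_cast
    rw [mul_div_assoc]
  rw [e1, e2]
  have : 0 < √(2 * (k : ℝ)) := Real.sqrt_pos.2 (by positivity)
  have : 0 < √(g : ℝ) := Real.sqrt_pos.2 (by positivity)
  have : 0 < Real.exp 1 := Real.exp_pos _
  rw [mul_assoc, div_mul_cancel₀]
  positivity

/-- the comparison sequence -/
def ZZ (c : ℕ → ℚ) (g : ℕ) : ℝ :=
  2 * (aa c g (3 * g) : ℝ) / (W g (3 * g - 1) * (50 ^ g * ((g - 1).factorial : ℝ) ^ 2))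

lemma ZZ_eq {c : ℕ → ℚ} (H : IsC c) (g : ℕ) (hg : 1 ≤ g) :
    ZZ c g = Stirling.stirlingSeq (6 * g) * Stirling.stirlingSeq (5 * g) /
      (Stirling.stirlingSeq (3 * g) ^ 2 * Stirling.stirlingSeq (2 * g) * Stirling.stirlingSeq (1 * g) ^ 3) *
      (√15 / 2 * ((g : ℝ) / (5 * g - 1))) := by
  have ha := congrArg (fun q : ℚ => (q : ℝ)) (aa_top c H.h0 (c_conv H) g)
  push_cast at ha
  have hgp : (1 : ℝ) ≤ g := by exact_mod_cast hg
  have h5 : (0 : ℝ) < 5 * g - 1 := by linarith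
  have ha' : (aa c g (3 * g) : ℝ) = (6 * g).factorial / (64 ^ g * (3 * g).factorial * g.factorial) := by
    rw [eq_div_iff (by positivity)]; exact ha
  have hf : (((g - 1).factorial : ℕ) : ℝ) = (g.factorial : ℝ) / g := by
    rw [eq_div_iff (by positivity), mul_comm]
    exact_mod_cast Nat.mul_factorial_pred (by omega)
  have step : ZZ c g = ((6 * g).factorial * (5 * g).factorial : ℝ) /
      ((3 * g).factorial ^ 2 * (2 * g).factorial * g.factorial ^ 3) *
      (8 ^ g / (64 ^ g * 125 ^ g * 50 ^ g)) * (6 * (g : ℝ) ^ 3 / (5 * g - 1)) := by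
    unfold ZZ
    rw [W_last g hg, ha', hf]
    field_simp
    try ring
  have f1 := fact_eq 1 g le_rfl hg
  have f2 := fact_eq 2 g (by norm_num) hg
  have f3 := fact_eq 3 g (by norm_num) hg
  have f5 := fact_eq 5 g (by norm_num) hg
  have f6 := fact_eq 6 g (by norm_num) hg
  have e1 : g.factorial = (1 * g).factorial := by rw [one_mul]
  rw [step, e1, f1, f2, f3, f5, f6]
  have sp : ∀ k, 1 ≤ k → 0 < Stirling.stirlingSeq (k * g) := by
    intro k hk
    obtain ⟨m, hm⟩ : ∃ m, k * g = m + 1 := ⟨k * g - 1, by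
      have : 0 < k * g := by positivity
      omega⟩
    rw [hm]; exact Stirling.stirlingSeq'_pos m
  have s1 := sp 1 (by norm_num)
  have s2 := sp 2 (by norm_num)
  have s3 := sp 3 (by norm_num)
  have s5 := sp 5 (by norm_num)
  have s6 := sp 6 (by norm_num)
  generalize Stirling.stirlingSeq (1 * g) = S1 at *
  generalize Stirling.stirlingSeq (2 * g) = S2 at *
  generalize Stirling.stirlingSeq (3 * g) = S3 at *
  generalize Stirling.stirlingSeq (5 * g) = S5 at *
  generalize Stirling.stirlingSeq (6 * g) = S6 at *
  have hL : 0 < ((g : ℝ) / Real.exp 1) ^ g := by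
    have : 0 < Real.exp 1 := Real.exp_pos _
    positivity
  generalize ((g : ℝ) / Real.exp 1) ^ g = L at *
  have hpow : (((6 : ℕ) : ℝ) ^ 6) ^ g * (((5 : ℕ) : ℝ) ^ 5) ^ g * 8 ^ g =
      ((((3 : ℕ) : ℝ) ^ 3) ^ g) ^ 2 * (((2 : ℕ) : ℝ) ^ 2) ^ g * ((((1 : ℕ) : ℝ) ^ 1) ^ g) ^ 3 *
        (64 ^ g * 125 ^ g * 50 ^ g) := by
    simp only [pow_right_comm _ g, ← mul_pow]
    norm_num
  have p1 : 0 < (((1 : ℕ) : ℝ) ^ 1) ^ g := by positivity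
  have p2 : 0 < (((2 : ℕ) : ℝ) ^ 2) ^ g := by positivity
  have p3 : 0 < (((3 : ℕ) : ℝ) ^ 3) ^ g := by positivity
  have pQ : (0 : ℝ) < 64 ^ g * 125 ^ g * 50 ^ g := by positivity
  generalize (((6 : ℕ) : ℝ) ^ 6) ^ g = P6 at *
  generalize (((5 : ℕ) : ℝ) ^ 5) ^ g = P5 at *
  generalize (((3 : ℕ) : ℝ) ^ 3) ^ g = P3 at *
  generalize (((2 : ℕ) : ℝ) ^ 2) ^ g = P2 at *
  generalize (((1 : ℕ) : ℝ) ^ 1) ^ g = P1 at *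
  generalize (64 : ℝ) ^ g * 125 ^ g * 50 ^ g = Q at *
  generalize (8 : ℝ) ^ g = P8 at *
  have r1 : √(2 * ((1 : ℕ) : ℝ)) = √2 := by norm_num
  have r2 : √(2 * ((2 : ℕ) : ℝ)) = 2 := by
    rw [show (2 * ((2 : ℕ) : ℝ)) = 2 ^ 2 by norm_num]; exact Real.sqrt_sq (by norm_num)
  have r3 : √(2 * ((3 : ℕ) : ℝ)) ^ 2 = 6 := by
    rw [Real.sq_sqrt (by positivity)]; norm_num
  have r56 : √(2 * ((6 : ℕ) : ℝ)) * √(2 * ((5 : ℕ) : ℝ)) = 2 * √2 * √15 := by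
    rw [← Real.sqrt_mul (by positivity)]
    have : (2 * ((6 : ℕ) : ℝ)) * (2 * ((5 : ℕ) : ℝ)) = 2 ^ 2 * 2 * 15 := by norm_num
    rw [this, Real.sqrt_mul (by norm_num), Real.sqrt_mul (by norm_num),
      Real.sqrt_sq (by norm_num)]
  have r22 : √2 ^ 2 = (2 : ℝ) := Real.sq_sqrt (by norm_num)
  have hr2 : (0 : ℝ) < √2 := Real.sqrt_pos.2 (by norm_num)
  have hgg : √(g : ℝ) ^ 2 = g := Real.sq_sqrt (by positivity)
  have hrg : 0 < √(g : ℝ) := Real.sqrt_pos.2 (by linarith)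
  rw [r1, r2]
  have hr3 : 0 < √(2 * ((3 : ℕ) : ℝ)) := Real.sqrt_pos.2 (by norm_num)
  generalize √(2 * ((3 : ℕ) : ℝ)) = R3 at *
  generalize √(2 * ((6 : ℕ) : ℝ)) = R6 at *
  generalize √(2 * ((5 : ℕ) : ℝ)) = R5 at *
  generalize √(g : ℝ) = r at *
  generalize √(2 : ℝ) = t at *
  generalize √(15 : ℝ) = v at *
  rw [← hgg] at h5 ⊢
  calc _ = (S6 * S5 / (S3 ^ 2 * S2 * S1 ^ 3)) * (R6 * R5 / (R3 ^ 2 * 2 * (t ^ 2 * t))) *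
        ((P6 * P5 * P8) / (P3 ^ 2 * P2 * P1 ^ 3 * Q)) * (1 / r ^ 4) * (6 * (r ^ 2) ^ 3 / (5 * r ^ 2 - 1)) := by
        field_simp
        try ring
    _ = _ := by
        rw [r56, r3, r22, hpow, div_self (by positivity)]
        field_simp
        try ring

end


lemma ZZ_lim {c : ℕ → ℚ} (H : IsC c) :
    Filter.Tendsto (ZZ c) Filter.atTop (nhds (1 / (2 * Real.pi ^ 2) * Real.sqrt (3 / 5))) := by
  have hs : ∀ k : ℕ, 1 ≤ k → Filter.Tendsto (fun g : ℕ => Stirling.stirlingSeq (k * g))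
      Filter.atTop (nhds (√Real.pi)) := fun k hk =>
    Stirling.tendsto_stirlingSeq_sqrt_pi.comp
      (Filter.tendsto_atTop_mono (fun g => Nat.le_mul_of_pos_left g hk) Filter.tendsto_id)
  have hg : Filter.Tendsto (fun g : ℕ => (g : ℝ) / (5 * g - 1)) Filter.atTop (nhds (1 / 5)) := by
    have h1 : Filter.Tendsto (fun g : ℕ => (1 : ℝ) / (5 - 1 / (g : ℝ))) Filter.atTop
        (nhds (1 / (5 - 0))) :=
      tendsto_const_nhds.div (tendsto_const_nhds.sub tendsto_one_div_atTop_nhds_zero_nat) (by norm_num)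
    rw [sub_zero] at h1
    refine h1.congr' ?_
    filter_upwards [Filter.eventually_ge_atTop 1] with g hg
    have : (1 : ℝ) ≤ g := by exact_mod_cast hg
    have h5 : (5 * (g : ℝ) - 1) ≠ 0 := by apply ne_of_gt; linarith
    have : (5 - 1 / (g : ℝ)) = (5 * g - 1) / g := by field_simp
    rw [this]; field_simp
  have hp : 0 < √Real.pi := Real.sqrt_pos.2 Real.pi_pos
  have hlim := (((hs 6 (by norm_num)).mul (hs 5 (by norm_num))).div
    ((((hs 3 (by norm_num)).pow 2).mul (hs 2 (by norm_num))).mul ((hs 1 le_rfl).pow 3))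
    (by positivity)).mul ((tendsto_const_nhds (x := √15 / 2)).mul hg)
  have e : 1 / (2 * Real.pi ^ 2) * Real.sqrt (3 / 5) =
      √Real.pi * √Real.pi / (√Real.pi ^ 2 * √Real.pi * √Real.pi ^ 3) * (√15 / 2 * (1 / 5)) := by
    have e1 : √(3 / 5 : ℝ) = √15 / 5 := by
      rw [show (3 / 5 : ℝ) = 15 / 5 ^ 2 by norm_num, Real.sqrt_div (by norm_num),
        Real.sqrt_sq (by norm_num)]
    have e2 : √Real.pi * √Real.pi / (√Real.pi ^ 2 * √Real.pi * √Real.pi ^ 3) =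
        1 / (√Real.pi ^ 2) ^ 2 := by
      field_simp
    rw [e1, e2, Real.sq_sqrt Real.pi_pos.le]
    field_simp
  rw [e]
  refine hlim.congr' ?_
  filter_upwards [Filter.eventually_ge_atTop 1] with g hg
  exact (ZZ_eq H g hg).symm

lemma ratio_lim {c : ℕ → ℚ} (H : IsC c) :
    Filter.Tendsto (fun g : ℕ => ((2 * aa c g (3 * g) / (c g * W g (3 * g - 1)) : ℚ) : ℝ))
      Filter.atTop (nhds 1) := by
  obtain ⟨K, _, h⟩ := main_bound H
  rw [tendsto_iff_norm_sub_tendsto_zero]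
  have hb : Filter.Tendsto (fun g : ℕ => (2 * K : ℝ) * (1 / (g : ℝ))) Filter.atTop (nhds 0) := by
    simpa using (tendsto_one_div_atTop_nhds_zero_nat (𝕜 := ℝ)).const_mul (2 * K : ℝ)
  refine tendsto_of_tendsto_of_tendsto_of_le_of_le' tendsto_const_nhds hb
    (Filter.Eventually.of_forall fun _ => norm_nonneg _) ?_
  filter_upwards [Filter.eventually_ge_atTop 5] with g hg
  have hc := c_pos H g (by omega)
  have hw := W_pos g (3 * g - 1) (by omega) le_rfl
  have h1 := h g hg
  have hcw : 0 < c g * W g (3 * g - 1) := by positivity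
  have e : 2 * aa c g (3 * g) / (c g * W g (3 * g - 1)) - 1 =
      2 * (aa c g (3 * g) - c g / 2 * W g (3 * g - 1)) / (c g * W g (3 * g - 1)) := by
    field_simp
  have h2 : |2 * aa c g (3 * g) / (c g * W g (3 * g - 1)) - 1| ≤ 2 * K * (1 / g) := by
    rw [e, abs_div, abs_of_pos hcw, div_le_iff₀ hcw, abs_mul, abs_of_pos (by norm_num : (0:ℚ) < 2)]
    calc _ ≤ 2 * (K / g * (c g * W g (3 * g - 1))) := by gcongr
      _ = _ := by ring
  rw [Real.norm_eq_abs]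
  have h3 := (Rat.cast_le (K := ℝ)).2 h2
  push_cast at h3 ⊢
  exact h3

/-- The coefficients of the formal solution `U(X) = Σ_g c_g X^{(1−5g)/2}` of the
Painlevé I equation `U'' + U²/16 − X/16 = 0` satisfy
`c_g / (50^g ((g−1)!)²) → (1/(2π²))·√(3/5)` as `g → ∞`. -/
theorem painleveI_coefficient_asymptotics (c : ℕ → ℚ)
    (h0 : c 0 = -1) (h1 : c 1 = 2) (h2 : c 2 = 98)
    (hrec : ∀ g : ℕ, 3 ≤ g →
      c g = 50 * ((g : ℚ) - 1) ^ 2 * c (g - 1) +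
        (1 / 2) * ∑ h ∈ Finset.Icc 2 (g - 2), c h * c (g - h)) :
    Filter.Tendsto
      (fun g : ℕ => (c g : ℝ) / (50 ^ g * ((g - 1).factorial : ℝ) ^ 2))
      Filter.atTop (nhds (1 / (2 * Real.pi ^ 2) * Real.sqrt (3 / 5))) := by
  have H : IsC c := ⟨h0, h1, h2, hrec⟩
  have hl := (ZZ_lim H).div (ratio_lim H) one_ne_zero
  rw [div_one] at hl
  refine hl.congr' ?_
  filter_upwards [Filter.eventually_ge_atTop 1] with g hg
  have hc : (0 : ℝ) < c g := by exact_mod_cast c_pos H g hg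
  have hw : (0 : ℝ) < W g (3 * g - 1) := by exact_mod_cast W_pos g (3 * g - 1) hg le_rfl
  have ht := aa_top c H.h0 (c_conv H) g
  have ha : aa c g (3 * g) ≠ 0 := by
    intro h
    rw [h, zero_mul] at ht
    exact (Nat.cast_ne_zero.2 (Nat.factorial_ne_zero (6 * g))) ht.symm
  have ha' : (aa c g (3 * g) : ℝ) ≠ 0 := by exact_mod_cast ha
  have hf : ((g - 1).factorial : ℝ) ≠ 0 := by positivity
  simp only [Pi.div_apply]
  unfold ZZ
  push_cast
  field_simp

end WittenAsym
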